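/- arXiv:2402.10783 — 11 statements merged into one kernel-verified Lean document; each statement's English description precedes it below -/
import Mathlib

section
/- There exists a constant c > 0 such that for every integer N ≥ 2 and every integer k with 1 ≤ k ≤ N, there exists a (k,N)-permutation selector S_0, S_1, ..., S_{m-1} of size m ≤ c·k²·log N. -/
/-- `S` is a `(k,N)`-permutation selector: for every `X ⊆ {0,…,N-1}` of size `k`
and every enumeration `x 1, …, x k` of `X`, there are increasing indices
`i 1 < … < i k` such that `S (i l) ∩ X = {x l}` for every `l`. -/
def IsPermutationSelector (N k m : ℕ) (S : Fin m → Finset (Fin N)) : Prop :=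
  ∀ X : Finset (Fin N), X.card = k →
    ∀ x : Fin k → Fin N, Function.Injective x → X = Finset.image x Finset.univ →
      ∃ i : Fin k → Fin m, StrictMono i ∧ ∀ l : Fin k, S (i l) ∩ X = {x l}

open Finset in
/-- Among the colourings of `V` with `2 * k` colours, a fraction of at least `1 / (4 * k)` has a
colour class of `0` that isolates a given element from a given set of size at most `k`. -/
theorem card_colorings_le_card_isolating {V : Type*} [Fintype V] [DecidableEq V] {k : ℕ}
    [NeZero (2 * k)] {X : Finset V} {a : V} (ha : a ∈ X) (hX : X.card ≤ k) :
    ((2 * k : ℕ) : ℝ) ^ Fintype.card V ≤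
      4 * k * (#{f : V → Fin (2 * k) | ({v | f v = 0} : Finset V) ∩ X = {a}} : ℝ) := by
  classical
  have hk : 0 < k := (card_pos.2 ⟨a, ha⟩).trans_le hX
  have hk' : (0 : ℝ) < k := by exact_mod_cast hk
  set B : V → Finset (Fin (2 * k)) := fun v =>
    if v = a then {0} else if v ∈ X then {0}ᶜ else univ with hB
  have hsub : Fintype.piFinset B ⊆
      ({f : V → Fin (2 * k) | ({v | f v = 0} : Finset V) ∩ X = {a}} : Finset _) := by
    intro f hf
    rw [Fintype.mem_piFinset] at hf
    rw [mem_filter]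
    refine ⟨mem_univ _, ?_⟩
    ext v
    have hv := hf v
    by_cases hva : v = a
    · subst hva
      simpa [hB, ha] using hv
    · by_cases hvX : v ∈ X <;> simp_all
  have hcard : ((Fintype.piFinset B).card : ℝ) =
      ∏ v, ((2 * k : ℝ) *
        (if v ∈ X then (if v = a then 1 / (2 * k : ℝ) else 1 - 1 / (2 * k)) else 1)) := by
    rw [Fintype.card_piFinset, Nat.cast_prod]
    refine prod_congr rfl fun v _ => ?_
    by_cases hva : v = a
    · subst hva
      simp [hB, ha]
      field_simp
    · by_cases hvX : v ∈ X
      · simp only [hB, hva, hvX, if_true, if_false, card_compl, card_singleton, Fintype.card_fin]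
        rw [Nat.cast_sub (by omega)]
        push_cast
        field_simp
      · simp [hB, hva, hvX]
  have hprod : ∏ v, (if v ∈ X then (if v = a then 1 / (2 * k : ℝ) else 1 - 1 / (2 * k)) else 1) =
      1 / (2 * k) * (1 - 1 / (2 * k)) ^ (X.card - 1) := by
    rw [prod_ite_mem, univ_inter, ← mul_prod_erase X _ ha, if_pos rfl]
    congr 1
    rw [prod_congr rfl fun v hv => if_neg (ne_of_mem_erase hv), prod_const, card_erase_of_mem ha]
  have hbern : (1 / 2 : ℝ) ≤ (1 - 1 / (2 * k)) ^ (X.card - 1) := by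
    have hk1 : (1 : ℝ) ≤ k := by exact_mod_cast hk
    have h1 : 1 / (2 * k : ℝ) ≤ 1 / 2 := by
      apply one_div_le_one_div_of_le <;> linarith
    have h2 := one_add_mul_le_pow (a := -(1 / (2 * k : ℝ))) (by linarith) (X.card - 1)
    have h3 : ((X.card - 1 : ℕ) : ℝ) ≤ k := by exact_mod_cast (Nat.sub_le _ _).trans hX
    have h4 : ((X.card - 1 : ℕ) : ℝ) * (1 / (2 * k)) ≤ k * (1 / (2 * k)) := by gcongr
    have h5 : (k : ℝ) * (1 / (2 * k)) = 1 / 2 := by field_simp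
    rw [← sub_eq_add_neg] at h2
    linarith
  have hle : ((Fintype.piFinset B).card : ℝ) ≤ _ := Nat.cast_le.2 (card_le_card hsub)
  refine le_trans ?_ (mul_le_mul_of_nonneg_left hle (by positivity))
  rw [hcard, prod_mul_distrib, prod_const, card_univ, hprod]
  push_cast
  calc (2 * k : ℝ) ^ Fintype.card V
      = 4 * k * ((2 * k) ^ Fintype.card V * (1 / (2 * k) * (1 / 2))) := by field_simp; norm_num
    _ ≤ _ := by gcongr

open Finset in
/-- Given weighted pairs `a i ∈ X i` with `X i` of size at most `k`, a single set isolates `a i`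
from `X i` for a fraction of at least `1 / (4 * k)` of the total weight. -/
theorem exists_isolating_weight {V ι : Type*} [Fintype V] [DecidableEq V] [Fintype ι] {k : ℕ}
    (hk : 0 < k) (X : ι → Finset V) (a : ι → V) (ha : ∀ i, a i ∈ X i) (hX : ∀ i, (X i).card ≤ k)
    (w : ι → ℝ) (hw : ∀ i, 0 ≤ w i) :
    ∃ A : Finset V, ∑ i, w i ≤ 4 * k * ∑ i, if A ∩ X i = {a i} then w i else 0 := by
  classical
  have : NeZero (2 * k) := ⟨by omega⟩
  have key : ∑ _f : V → Fin (2 * k), ∑ i, w i ≤ ∑ f : V → Fin (2 * k),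
      4 * k * ∑ i, if ({v | f v = 0} : Finset V) ∩ X i = {a i} then w i else 0 := by
    rw [← mul_sum, sum_comm, sum_comm (s := univ (α := V → Fin (2 * k))), mul_sum]
    refine sum_le_sum fun i _ => ?_
    rw [sum_const, ← sum_filter, sum_const, card_univ, Fintype.card_fun, Fintype.card_fin,
      nsmul_eq_mul, nsmul_eq_mul, ← mul_assoc, Nat.cast_pow]
    exact mul_le_mul_of_nonneg_right (card_colorings_le_card_isolating (ha i) (hX i)) (hw i)
  obtain ⟨f, -, hf⟩ := exists_le_of_sum_le univ_nonempty key
  exact ⟨_, hf⟩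

/-- A sequence that starts at `0` and increases by at most one in each step passes every level
below its value at time `m`, at strictly increasing times before `m`. -/
theorem exists_strictMono_crossing {p : ℕ → ℕ} (h0 : p 0 = 0)
    (hp : ∀ t, p (t + 1) = p t ∨ p (t + 1) = p t + 1) {k m : ℕ} (hm : k ≤ p m) :
    ∃ i : Fin k → Fin m, StrictMono i ∧ ∀ l, p (i l) = l ∧ p (i l + 1) = l + 1 := by
  have hmono : Monotone p := monotone_nat_of_le_succ fun t => by
    rcases hp t with h | h <;> omega
  have hex : ∀ l : Fin k, ∃ t : Fin m, p t = l ∧ p (t + 1) = l + 1 := by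
    intro l
    have hl : ∃ t, (l : ℕ) < p t := ⟨m, l.2.trans_le hm⟩
    have hspec := Nat.find_spec hl
    have hle : Nat.find hl ≤ m := Nat.find_min' hl (l.2.trans_le hm)
    obtain ⟨t, ht⟩ : ∃ t, Nat.find hl = t + 1 := Nat.exists_eq_succ_of_ne_zero fun h => by
      rw [h, h0] at hspec
      omega
    have hmin : ¬ (l : ℕ) < p t := Nat.find_min hl (by omega)
    rw [ht] at hspec
    refine ⟨⟨t, by omega⟩, ?_⟩
    rcases hp t with h | h <;> constructor <;> simp only <;> omega
  choose i hi using hex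
  refine ⟨i, fun l l' hll' => ?_, hi⟩
  by_contra! h
  have := hmono (show (i l' : ℕ) ≤ i l from h)
  rw [(hi l).1, (hi l').1] at this
  exact absurd hll' (not_lt.2 this)

section Greedy

open Finset

variable {N k : ℕ}

/-- The number of elements of each enumeration isolated in order, updated greedily after the
set `A` is appended to the sequence. The next element is read cyclically. -/
def greedyStep [NeZero k] (A : Finset (Fin N)) (j : (Fin k ↪ Fin N) → ℕ) (x : Fin k ↪ Fin N) : ℕ :=
  if A ∩ univ.image x = {x (Fin.ofNat k (j x))} then j x + 1 else j x

/-- The total weight of the enumerations, where one with `r` elements still to be isolated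
has weight `2 ^ r - 1`. -/
noncomputable def greedyPotential (j : (Fin k ↪ Fin N) → ℕ) : ℝ :=
  ∑ x, ((2 : ℝ) ^ (k - j x) - 1)

theorem exists_greedyPotential_step_le [NeZero k] (j : (Fin k ↪ Fin N) → ℕ) :
    ∃ A, greedyPotential (greedyStep A j) ≤ (1 - 1 / (8 * k)) * greedyPotential j := by
  have hk : 0 < k := Nat.pos_of_ne_zero (NeZero.ne k)
  have hk' : (0 : ℝ) < k := by exact_mod_cast hk
  obtain ⟨A, hA⟩ := exists_isolating_weight hk (fun x : Fin k ↪ Fin N => univ.image x)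
    (fun x => x (Fin.ofNat k (j x))) (fun x => mem_image_of_mem _ (mem_univ _))
    (fun x => card_image_le.trans (by simp)) (fun x => (2 : ℝ) ^ (k - j x) - 1)
    (fun x => sub_nonneg.2 (one_le_pow₀ one_le_two))
  refine ⟨A, ?_⟩
  have hstep : greedyPotential (greedyStep A j) ≤ greedyPotential j - 1 / 2 *
      ∑ x : Fin k ↪ Fin N, if A ∩ univ.image x = {x (Fin.ofNat k (j x))} then
        (2 : ℝ) ^ (k - j x) - 1 else 0 := by
    rw [greedyPotential, greedyPotential, mul_sum, ← sum_sub_distrib]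
    refine sum_le_sum fun x _ => ?_
    unfold greedyStep
    split_ifs
    · rcases Nat.lt_or_ge (j x) k with h | h
      · rw [show k - j x = k - (j x + 1) + 1 by omega, pow_succ]
        linarith
      · rw [Nat.sub_eq_zero_of_le h, Nat.sub_eq_zero_of_le (h.trans (Nat.le_succ _))]
        norm_num
    · simp
  change greedyPotential j ≤ _ at hA
  have hA' : 1 / (8 * k) * greedyPotential j ≤ 1 / (8 * k) * _ :=
    mul_le_mul_of_nonneg_left hA (by positivity)
  rw [← mul_assoc, show 1 / (8 * k) * (4 * k) = (1 / 2 : ℝ) by field_simp; norm_num] at hA'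
  linarith

theorem greedyPotential_zero_le :
    greedyPotential (0 : (Fin k ↪ Fin N) → ℕ) ≤ (2 * N : ℝ) ^ k := by
  have hcard : (Fintype.card (Fin k ↪ Fin N) : ℝ) ≤ (N : ℝ) ^ k := by
    rw [Fintype.card_embedding_eq, Fintype.card_fin, Fintype.card_fin]
    exact_mod_cast Nat.descFactorial_le_pow N k
  calc greedyPotential (0 : (Fin k ↪ Fin N) → ℕ)
      = Fintype.card (Fin k ↪ Fin N) * ((2 : ℝ) ^ k - 1) := by
        simp [greedyPotential, -Fintype.card_embedding_eq, mul_sub]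
    _ ≤ (N : ℝ) ^ k * 2 ^ k := by
        gcongr
        · exact sub_nonneg.2 (one_le_pow₀ one_le_two)
        · linarith
    _ = (2 * N : ℝ) ^ k := by rw [mul_pow, mul_comm]

theorem le_of_greedyPotential_lt_one {j : (Fin k ↪ Fin N) → ℕ} (hj : greedyPotential j < 1)
    (x : Fin k ↪ Fin N) : k ≤ j x := by
  by_contra! h
  have hx : (2 : ℝ) ^ (k - j x) - 1 ≤ greedyPotential j :=
    single_le_sum (f := fun x => (2 : ℝ) ^ (k - j x) - 1)
      (fun y _ => sub_nonneg.2 (one_le_pow₀ one_le_two)) (mem_univ x)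
  have h2 : (2 : ℝ) ^ 1 ≤ 2 ^ (k - j x) := pow_le_pow_right₀ one_le_two (by omega)
  linarith

theorem exists_isPermutationSelector_of_pow_lt_one [NeZero k] {m : ℕ}
    (hm : (1 - 1 / (8 * k : ℝ)) ^ m * (2 * N : ℝ) ^ k < 1) :
    ∃ S : Fin m → Finset (Fin N), IsPermutationSelector N k m S := by
  choose F hF using exists_greedyPotential_step_le (N := N) (k := k)
  have hk1 : (1 : ℝ) ≤ k := by exact_mod_cast Nat.pos_of_ne_zero (NeZero.ne k)
  have hq : 0 ≤ 1 - 1 / (8 * k : ℝ) := by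
    rw [sub_nonneg, div_le_one (by positivity)]
    linarith
  set s : ℕ → (Fin k ↪ Fin N) → ℕ := fun t => (fun j => greedyStep (F j) j)^[t] 0 with hs
  have hs_succ : ∀ t, s (t + 1) = greedyStep (F (s t)) (s t) := fun t =>
    Function.iterate_succ_apply' _ _ _
  have hpot : ∀ t, greedyPotential (s t) ≤ (1 - 1 / (8 * k : ℝ)) ^ t * (2 * N : ℝ) ^ k := by
    intro t
    induction t with
    | zero => simpa [hs] using greedyPotential_zero_le
    | succ t ih =>
      rw [hs_succ, pow_succ', mul_assoc]
      exact (hF _).trans (mul_le_mul_of_nonneg_left ih hq)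
  refine ⟨fun t => F (s t), fun X _ x hx hX => ?_⟩
  obtain ⟨i, hi, hil⟩ := exists_strictMono_crossing (p := fun t => s t ⟨x, hx⟩) rfl
    (fun t => by
      simp only [hs_succ, greedyStep]
      split_ifs <;> simp)
    (le_of_greedyPotential_lt_one ((hpot m).trans_lt hm) ⟨x, hx⟩)
  refine ⟨i, hi, fun l => ?_⟩
  obtain ⟨h1, h2⟩ := hil l
  simp only [hs_succ, greedyStep, h1] at h2
  split_ifs at h2 with h
  · simpa [hX] using h
  · omega

end Greedy

theorem exists_permutation_selector :
    ∃ c : ℝ, 0 < c ∧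
      ∀ N k : ℕ, 2 ≤ N → 1 ≤ k → k ≤ N →
        ∃ (m : ℕ) (S : Fin m → Finset (Fin N)),
          (m : ℝ) ≤ c * (k : ℝ) ^ 2 * Real.log N ∧ IsPermutationSelector N k m S := by
  refine ⟨20, by norm_num, fun N k hN hk _ => ?_⟩
  have : NeZero k := ⟨by omega⟩
  have hk1 : (1 : ℝ) ≤ k := by exact_mod_cast hk
  have hN2 : (2 : ℝ) ≤ N := by exact_mod_cast hN
  have hlog2 := Real.log_two_gt_d9
  have hlogN : Real.log 2 ≤ Real.log N := Real.log_le_log (by norm_num) hN2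
  have hlog : Real.log (2 * N) = Real.log 2 + Real.log N :=
    Real.log_mul (by norm_num) (by positivity)
  set M : ℝ := 8 * k ^ 2 * Real.log (2 * N) with hM
  have hM0 : 0 ≤ M := mul_nonneg (by positivity) (by linarith)
  obtain ⟨S, hS⟩ := exists_isPermutationSelector_of_pow_lt_one (N := N) (k := k)
    (m := ⌊M⌋₊ + 1) (by
      have hq : 0 ≤ 1 - 1 / (8 * k : ℝ) := by
        rw [sub_nonneg, div_le_one (by positivity)]
        linarith
      have hpow : (2 * N : ℝ) ^ k = Real.exp (k * Real.log (2 * N)) := by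
        rw [Real.exp_nat_mul, Real.exp_log (by positivity)]
      have hlt : k * Real.log (2 * N) < (⌊M⌋₊ + 1 : ℕ) * (1 / (8 * k)) := by
        rw [mul_one_div, lt_div_iff₀ (by positivity)]
        calc k * Real.log (2 * N) * (8 * k) = M := by rw [hM]; ring
          _ < _ := by exact_mod_cast Nat.lt_floor_add_one M
      calc (1 - 1 / (8 * k : ℝ)) ^ (⌊M⌋₊ + 1) * (2 * N : ℝ) ^ k
          ≤ Real.exp (-(1 / (8 * k))) ^ (⌊M⌋₊ + 1) * (2 * N : ℝ) ^ k := by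
            gcongr
            exact Real.one_sub_le_exp_neg _
        _ = Real.exp (((⌊M⌋₊ + 1 : ℕ) : ℝ) * -(1 / (8 * k)) + k * Real.log (2 * N)) := by
            rw [hpow, ← Real.exp_nat_mul, ← Real.exp_add]
        _ < 1 := by rw [Real.exp_lt_one_iff]; linarith)
  refine ⟨_, S, ?_, hS⟩
  push_cast
  have hfloor := Nat.floor_le hM0
  have hk2 : (1 : ℝ) ≤ (k : ℝ) ^ 2 := one_le_pow₀ hk1
  have h1 : M ≤ 8 * k ^ 2 * (2 * Real.log N) := by
    rw [hM, hlog]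
    gcongr
    linarith
  have h2 : 1 * (1 / 2) ≤ (k : ℝ) ^ 2 * Real.log N :=
    mul_le_mul hk2 (by linarith) (by norm_num) (by positivity)
  linarith
end

section
/- There exists a constant c > 0 such that for every integer N ≥ 2 and all integers k, q with 1 ≤ q ≤ k ≤ N, there exists a (k,q,N)-permutation selector S_0, S_1, ..., S_{m-1} of size m ≤ c·k·q·log N. -/
/-- `S` is a `(k,q,N)`-permutation selector: for every `X ⊆ {0,…,N-1}` of size `k`
and every enumeration `x 1, …, x k` of `X`, there are increasing indices
`i 1 < … < i q` and increasing positions `d 1 < … < d q` such that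
`S (i l) ∩ X = {x (d l)}` for every `l`. -/
def IsPermutationSelectorQ (N k q m : ℕ) (S : Fin m → Finset (Fin N)) : Prop :=
  ∀ X : Finset (Fin N), X.card = k →
    ∀ x : Fin k → Fin N, Function.Injective x → X = Finset.image x Finset.univ →
      ∃ (i : Fin q → Fin m) (d : Fin q → Fin k), StrictMono i ∧ StrictMono d ∧
        ∀ l : Fin q, S (i l) ∩ X = {x (d l)}

open Finset in
/-- The set of points which a colouring sends to the colour `0`. -/
def zeroClass {α : Type*} [Fintype α] {n : ℕ} (f : α → Fin (n + 1)) : Finset α :=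
  univ.filter fun a => f a = 0

theorem succ_pow_le_three_mul_pow (n : ℕ) : (n + 1) ^ n ≤ 3 * n ^ n := by
  rcases Nat.eq_zero_or_pos n with rfl | hn
  · simp
  have hn' : (0 : ℝ) < n := by exact_mod_cast hn
  have h1 : (1 + 1 / (n : ℝ)) ^ n ≤ 3 := by
    calc (1 + 1 / (n : ℝ)) ^ n ≤ (Real.exp (1 / n)) ^ n := by
          gcongr
          linarith [Real.add_one_le_exp (1 / (n : ℝ))]
      _ = Real.exp 1 := by
          rw [← Real.exp_nat_mul]
          congr 1
          field_simp
      _ ≤ 3 := by linarith [Real.exp_one_lt_d9]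
  have h2 : ((n : ℝ) + 1) ^ n ≤ 3 * (n : ℝ) ^ n := by
    calc ((n : ℝ) + 1) ^ n = (1 + 1 / (n : ℝ)) ^ n * (n : ℝ) ^ n := by
          rw [← mul_pow]
          congr 1
          field_simp
      _ ≤ 3 * (n : ℝ) ^ n := by gcongr
  exact_mod_cast h2

open Finset in
/-- A uniformly random colour class isolates a given point of `X` with probability at least
`1 / (3 * #X)`. -/
theorem card_colorings_le_isolating {α : Type*} [Fintype α] [DecidableEq α] {n : ℕ}
    {X : Finset α} (hX : #X = n + 1) {y : α} (hy : y ∈ X) :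
    (n + 1) ^ Fintype.card α ≤
      3 * (n + 1) * #{f : α → Fin (n + 1) | zeroClass f ∩ X = {y}} := by
  let s : α → Finset (Fin (n + 1)) := fun z => if z = y then {0} else if z ∈ X then {0}ᶜ else univ
  have hsub : Fintype.piFinset s ⊆
      ({f : α → Fin (n + 1) | zeroClass f ∩ X = {y}} : Finset _) := by
    intro f hf
    rw [Fintype.mem_piFinset] at hf
    rw [mem_filter]
    refine ⟨mem_univ _, ?_⟩
    ext z
    have hz := hf z
    simp only [s] at hz
    simp only [zeroClass, mem_inter, mem_filter, mem_univ, true_and, mem_singleton]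
    split_ifs at hz with h1 h2
    · subst h1
      simpa [hy] using hz
    · simpa [h1, h2] using hz
    · simp [h1, h2]
  have hcard : #(Fintype.piFinset s) = n ^ n * (n + 1) ^ (Fintype.card α - (n + 1)) := by
    rw [Fintype.card_piFinset, ← prod_mul_prod_compl X, ← mul_prod_erase X _ hy]
    have h1 : ∏ z ∈ X.erase y, #(s z) = n ^ n := by
      rw [prod_congr rfl (g := fun _ => n)]
      · simp [card_erase_of_mem hy, hX]
      · intro z hz
        rw [mem_erase] at hz
        simp [s, hz.1, hz.2, card_compl]
    have h2 : ∏ z ∈ Xᶜ, #(s z) = (n + 1) ^ (Fintype.card α - (n + 1)) := by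
      rw [prod_congr rfl (g := fun _ => n + 1)]
      · simp [card_compl, hX]
      · intro z hz
        rw [mem_compl] at hz
        have : z ≠ y := fun h => hz (h ▸ hy)
        simp [s, this, hz]
    rw [h1, h2]
    simp [s]
  have hle : n + 1 ≤ Fintype.card α := hX ▸ card_le_univ X
  obtain ⟨r, hr⟩ := Nat.exists_eq_add_of_le hle
  calc (n + 1) ^ Fintype.card α = (n + 1) ^ n * ((n + 1) * (n + 1) ^ r) := by rw [hr]; ring
    _ ≤ (3 * n ^ n) * ((n + 1) * (n + 1) ^ r) :=
        Nat.mul_le_mul_right _ (succ_pow_le_three_mul_pow n)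
    _ = 3 * (n + 1) * #(Fintype.piFinset s) := by
        rw [hcard, hr, Nat.add_sub_cancel_left]
        ring
    _ ≤ _ := Nat.mul_le_mul_left _ (card_le_card hsub)

open Finset in
/-- A uniformly random colour class isolates some point of the `l`-th block of `k / q` consecutive
positions with probability at least `1 / (6 * q)`. -/
theorem card_colorings_le_isolating_block {α : Type*} [Fintype α] [DecidableEq α] {n q l : ℕ}
    (hqk : q ≤ n + 1) (hl : l < q) {x : Fin (n + 1) → α}
    (hx : Function.Injective x) :
    (n + 1) ^ Fintype.card α ≤
      6 * q * #{f : α → Fin (n + 1) | ∃ j : Fin (n + 1), (j : ℕ) / ((n + 1) / q) = l ∧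
        zeroClass f ∩ univ.image x = {x j}} := by
  set b := (n + 1) / q with hb
  have hq : 0 < q := by omega
  have hb0 : 0 < b := Nat.div_pos hqk hq
  have hbk : q * b ≤ n + 1 := Nat.mul_div_le _ _
  have hkb : n + 1 ≤ 2 * q * b := by
    have := Nat.lt_mul_div_succ (n + 1) hq
    rw [← hb] at this
    nlinarith
  let J : Finset (Fin (n + 1)) := univ.filter fun j => (j : ℕ) / b = l
  have hJ : b ≤ #J := by
    have hlt : ∀ a : Fin b, l * b + a < n + 1 := by
      intro a
      have := a.2
      nlinarith
    calc b = #(univ : Finset (Fin b)) := by simp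
      _ ≤ #J := by
        refine card_le_card_of_injOn (fun a => ⟨l * b + a, hlt a⟩) ?_ ?_
        · intro a _
          simp only [J, coe_filter, mem_univ, true_and, Set.mem_ofPred_eq]
          rw [Nat.mul_comm, Nat.mul_add_div hb0, Nat.div_eq_of_lt a.2, Nat.add_zero]
        · intro a _ a' _ h
          simpa [Fin.ext_iff] using h
  set H : Finset (α → Fin (n + 1)) := {f | ∃ j : Fin (n + 1), (j : ℕ) / b = l ∧
        zeroClass f ∩ univ.image x = {x j}} with hH
  have hHeq : H = J.biUnion fun j =>
      ({f : α → Fin (n + 1) | zeroClass f ∩ univ.image x = {x j}} : Finset _) := by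
    ext f
    simp [hH, J]
  have hcard : #(univ.image x) = n + 1 := by
    rw [card_image_of_injective _ hx]
    simp
  have hsum : (n + 1) ^ Fintype.card α * b ≤ 3 * (n + 1) * #H := by
    rw [hHeq, card_biUnion, mul_sum]
    · calc (n + 1) ^ Fintype.card α * b ≤ #J * (n + 1) ^ Fintype.card α := by
            rw [mul_comm]
            gcongr
        _ = ∑ _j ∈ J, (n + 1) ^ Fintype.card α := by simp
        _ ≤ _ := sum_le_sum fun j _ =>
            card_colorings_le_isolating hcard (mem_image_of_mem x (mem_univ j))
    · intro j _ j' _ hjj'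
      rw [Function.onFun_apply, disjoint_left]
      intro f hf hf'
      rw [mem_filter] at hf hf'
      exact hjj' (hx (singleton_injective (hf.2.symm.trans hf'.2)))
  refine Nat.le_of_mul_le_mul_right (c := b) ?_ hb0
  calc (n + 1) ^ Fintype.card α * b ≤ 3 * (n + 1) * #H := hsum
    _ ≤ 3 * (2 * q * b) * #H := by gcongr
    _ = 6 * q * #H * b := by ring

/-- Among the first `t` sets of the sequence there are `l` in increasing order such that the `a`-th
one isolates, from the range of `x`, a point in the `a`-th block of `b` consecutive positions. -/
def IsolatesBlocks {α : Type*} [DecidableEq α] {k : ℕ} (b t l : ℕ) (S : ℕ → Finset α)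
    (x : Fin k → α) : Prop :=
  ∃ (i : ℕ → ℕ) (d : ℕ → Fin k),
    (∀ a < l, i a < t ∧ (d a : ℕ) / b = a ∧ S (i a) ∩ Finset.univ.image x = {x (d a)}) ∧
      ∀ a' < l, ∀ a < a', i a < i a'

theorem IsolatesBlocks.update {α : Type*} [DecidableEq α] {k b t l : ℕ} {S : ℕ → Finset α}
    {x : Fin k → α} (h : IsolatesBlocks b t l S x) (T : Finset α) :
    IsolatesBlocks b (t + 1) l (Function.update S t T) x := by
  obtain ⟨i, d, h1, h2⟩ := h
  refine ⟨i, d, fun a ha => ?_, h2⟩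
  obtain ⟨h3, h4, h5⟩ := h1 a ha
  refine ⟨by omega, h4, ?_⟩
  rwa [Function.update_of_ne (by omega)]

theorem IsolatesBlocks.update_succ {α : Type*} [DecidableEq α] {k b t l : ℕ} {S : ℕ → Finset α}
    {x : Fin k → α} (h : IsolatesBlocks b t l S x) {T : Finset α} {j : Fin k}
    (hj : (j : ℕ) / b = l) (hT : T ∩ Finset.univ.image x = {x j}) :
    IsolatesBlocks b (t + 1) (l + 1) (Function.update S t T) x := by
  obtain ⟨i, d, h1, h2⟩ := h
  refine ⟨Function.update i l t, Function.update d l j, fun a ha => ?_, fun a' ha' a ha => ?_⟩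
  · rcases Nat.lt_succ_iff_lt_or_eq.1 ha with hal | rfl
    · obtain ⟨h3, h4, h5⟩ := h1 a hal
      rw [Function.update_of_ne (by omega), Function.update_of_ne (by omega),
        Function.update_of_ne (by omega)]
      exact ⟨by omega, h4, h5⟩
    · simp [hj, hT]
  · rw [Function.update_of_ne (show a ≠ l by omega)]
    rcases Nat.lt_succ_iff_lt_or_eq.1 ha' with hal | rfl
    · rw [Function.update_of_ne (by omega)]
      exact h2 a' hal a ha
    · rw [Function.update_self]
      exact (h1 a ha).1

/-- The potential of an enumeration for which `l` of `q` blocks have been isolated. -/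
noncomputable def blockWeight (q l : ℕ) : ℝ := if l < q then (1 / 2) ^ l else 0

theorem blockWeight_nonneg (q l : ℕ) : 0 ≤ blockWeight q l := by
  unfold blockWeight
  split_ifs <;> positivity

theorem blockWeight_succ_le (q l : ℕ) : blockWeight q (l + 1) ≤ blockWeight q l / 2 := by
  unfold blockWeight
  split_ifs with h1 h2
  · rw [pow_succ]
    linarith
  · omega
  · positivity
  · simp

open Finset in
/-- If each state below `q` advances with probability at least `δ`, then its expected potential
decreases by a factor `1 - δ / 2`. -/
theorem sum_blockWeight_le {Ω : Type*} [Fintype Ω] {q l : ℕ} {δ : ℝ}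
    (P : Ω → Prop) [DecidablePred P] (hP : l < q → δ * Fintype.card Ω ≤ #{f | P f}) :
    ∑ f, blockWeight q (if P f then l + 1 else l) ≤
      Fintype.card Ω * ((1 - δ / 2) * blockWeight q l) := by
  have hle : ∑ f, blockWeight q (if P f then l + 1 else l) ≤
      ∑ f, (blockWeight q l - if P f then blockWeight q l / 2 else 0) := by
    refine sum_le_sum fun f _ => ?_
    split_ifs
    · linarith [blockWeight_succ_le q l]
    · simp
  refine hle.trans ?_
  rw [sum_sub_distrib, ← sum_filter, sum_const, sum_const, card_univ, nsmul_eq_mul, nsmul_eq_mul]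
  by_cases hl : l < q
  · nlinarith [mul_le_mul_of_nonneg_right (hP hl) (blockWeight_nonneg q l)]
  · simp [blockWeight, hl]

open Finset in
/-- Greedily chosen sets make the total potential decay geometrically. -/
theorem exists_sets_sum_blockWeight_le {α : Type*} [Fintype α] [DecidableEq α] {n q : ℕ}
    (hq : 0 < q) (hqk : q ≤ n + 1) (t : ℕ) :
    ∃ (S : ℕ → Finset α) (l : (Fin (n + 1) ↪ α) → ℕ),
      (∀ x, IsolatesBlocks ((n + 1) / q) t (l x) S x) ∧
        ∑ x, blockWeight q (l x) ≤
          (1 - 1 / (12 * (q : ℝ))) ^ t * Fintype.card (Fin (n + 1) ↪ α) := by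
  classical
  have hq' : (1 : ℝ) ≤ q := by exact_mod_cast hq
  induction t with
  | zero =>
    refine ⟨fun _ => ∅, fun _ => 0, fun x => ⟨fun _ => 0, fun _ => 0, by simp, by simp⟩, ?_⟩
    simp [blockWeight, hq]
  | succ t ih =>
    obtain ⟨S, l, hS, hsum⟩ := ih
    let P : (Fin (n + 1) ↪ α) → (α → Fin (n + 1)) → Prop := fun x f =>
      ∃ j : Fin (n + 1), (j : ℕ) / ((n + 1) / q) = l x ∧ zeroClass f ∩ univ.image x = {x j}
    have hP : ∀ x, l x < q →
        1 / (6 * (q : ℝ)) * Fintype.card (α → Fin (n + 1)) ≤ #{f | P x f} := by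
      intro x hx
      have h : ((n : ℝ) + 1) ^ Fintype.card α ≤ 6 * q * #{f | P x f} := by
        exact_mod_cast card_colorings_le_isolating_block hqk hx x.injective
      rw [one_div_mul_eq_div, div_le_iff₀ (by positivity)]
      simp only [Fintype.card_fun, Fintype.card_fin]
      push_cast
      linarith
    have hdouble : ∑ f, ∑ x, blockWeight q (if P x f then l x + 1 else l x) ≤
        ∑ _f : α → Fin (n + 1), (1 - 1 / (12 * (q : ℝ))) * ∑ x, blockWeight q (l x) := by
      rw [sum_comm, sum_const, card_univ, nsmul_eq_mul, mul_sum, mul_sum]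
      refine sum_le_sum fun x _ => (sum_blockWeight_le (P x) (hP x)).trans_eq ?_
      congr 3
      field_simp
      norm_num
    obtain ⟨f, -, hf⟩ := exists_le_of_sum_le univ_nonempty hdouble
    refine ⟨Function.update S t (zeroClass f), fun x => if P x f then l x + 1 else l x,
      fun x => ?_, hf.trans ?_⟩
    · dsimp only
      split_ifs with h
      · obtain ⟨j, hj, hT⟩ := h
        exact (hS x).update_succ hj hT
      · exact (hS x).update _
    · rw [pow_succ', mul_assoc]
      refine mul_le_mul_of_nonneg_left hsum ?_
      rw [sub_nonneg, div_le_one (by positivity)]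
      linarith

theorem isPermutationSelectorQ_of_isolatesBlocks {N k q m : ℕ} {S : ℕ → Finset (Fin N)}
    (h : ∀ x : Fin k ↪ Fin N, ∃ l, q ≤ l ∧ IsolatesBlocks (k / q) m l S x) :
    IsPermutationSelectorQ N k q m fun i => S i := by
  rintro X - x hx rfl
  obtain ⟨l, hl, i, d, h1, h2⟩ := h ⟨x, hx⟩
  have hlt : ∀ a : Fin q, (a : ℕ) < l := fun a => a.2.trans_le hl
  refine ⟨fun a => ⟨i a, (h1 a (hlt a)).1⟩, fun a => d a, ?_, ?_, fun a => (h1 a (hlt a)).2.2⟩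
  · intro a a' ha
    exact h2 a' (hlt a') a ha
  · intro a a' ha
    by_contra! hle
    have := Nat.div_le_div_right (c := k / q) (Fin.le_def.1 hle)
    rw [(h1 a (hlt a)).2.1, (h1 a' (hlt a')).2.1] at this
    exact absurd (Fin.lt_def.1 ha) (by omega)

theorem exists_permutation_selector_q :
    ∃ c : ℝ, 0 < c ∧
      ∀ N k q : ℕ, 2 ≤ N → 1 ≤ q → q ≤ k → k ≤ N →
        ∃ (m : ℕ) (S : Fin m → Finset (Fin N)),
          (m : ℝ) ≤ c * (k : ℝ) * (q : ℝ) * Real.log N ∧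
            IsPermutationSelectorQ N k q m S := by
  refine ⟨26, by norm_num, fun N k q hN hq hqk hkN => ?_⟩
  obtain ⟨n, rfl⟩ : ∃ n, k = n + 1 := ⟨k - 1, by omega⟩
  set m := ⌈12 * (q : ℝ) * (((n + 1 : ℕ) : ℝ) * Real.log N + q * Real.log 2)⌉₊ with hm
  set K : ℝ := ((n + 1 : ℕ) : ℝ) with hK
  have hN' : (2 : ℝ) ≤ N := by exact_mod_cast hN
  have hq' : (1 : ℝ) ≤ q := by exact_mod_cast hq
  have hqK : (q : ℝ) ≤ K := by
    rw [hK]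
    exact_mod_cast hqk
  have hlog2 : 1 / 2 < Real.log 2 := by linarith [Real.log_two_gt_d9]
  have hlog : Real.log 2 ≤ Real.log N := Real.log_le_log (by norm_num) hN'
  obtain ⟨S, l, hS, hsum⟩ := exists_sets_sum_blockWeight_le (α := Fin N) hq hqk m
  refine ⟨m, fun i => S i, ?_, isPermutationSelectorQ_of_isolatesBlocks fun x =>
    ⟨l x, ?_, hS x⟩⟩
  · have hceil : (m : ℝ) < 12 * q * (K * Real.log N + q * Real.log 2) + 1 :=
      Nat.ceil_lt_add_one (by positivity)
    have h1 : (q : ℝ) * Real.log 2 ≤ K * Real.log N := by gcongr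
    have h2 : 12 * q * (K * Real.log N + q * Real.log 2) ≤
        12 * q * (K * Real.log N + K * Real.log N) := by gcongr
    have h3 : 1 / 2 ≤ K * q * Real.log N := by
      have : 1 ≤ K * q := by nlinarith
      nlinarith
    nlinarith
  · by_contra! hx
    have hm' : 12 * (q : ℝ) * (K * Real.log N + q * Real.log 2) ≤ m := Nat.le_ceil _
    have hcard : (Fintype.card (Fin (n + 1) ↪ Fin N) : ℝ) ≤ Real.exp (K * Real.log N) := by
      rw [hK, Real.exp_nat_mul, Real.exp_log (by linarith)]
      rw [Fintype.card_embedding_eq, Fintype.card_fin, Fintype.card_fin]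
      exact_mod_cast Nat.descFactorial_le_pow N (n + 1)
    have hpow : (1 - 1 / (12 * (q : ℝ))) ^ m ≤ Real.exp (-(m / (12 * q))) := by
      calc (1 - 1 / (12 * (q : ℝ))) ^ m ≤ Real.exp (-(1 / (12 * (q : ℝ)))) ^ m := by
            gcongr
            · rw [sub_nonneg, div_le_one (by positivity)]
              linarith
            · linarith [Real.add_one_le_exp (-(1 / (12 * (q : ℝ))))]
        _ = Real.exp (-(m / (12 * q))) := by
            rw [← Real.exp_nat_mul]
            congr 1
            ring
    have hupper : (1 / 2 : ℝ) ^ l x ≤ (1 / 2) ^ q := by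
      calc (1 / 2 : ℝ) ^ l x = blockWeight q (l x) := by simp [blockWeight, hx]
        _ ≤ ∑ x, blockWeight q (l x) :=
            Finset.single_le_sum (f := fun x => blockWeight q (l x))
              (fun _ _ => blockWeight_nonneg _ _) (Finset.mem_univ x)
        _ ≤ Real.exp (-(m / (12 * q))) * Real.exp (K * Real.log N) :=
            hsum.trans (by gcongr)
        _ ≤ Real.exp (q * -Real.log 2) := by
            rw [← Real.exp_add, Real.exp_le_exp]
            have : K * Real.log N + q * Real.log 2 ≤ m / (12 * q) := by
              rw [le_div_iff₀ (by positivity)]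
              linarith
            linarith
        _ = (1 / 2) ^ q := by
            rw [Real.exp_nat_mul, Real.exp_neg, Real.exp_log (by norm_num)]
            norm_num
    have hlower : (1 / 2 : ℝ) ^ q < (1 / 2) ^ l x :=
      pow_lt_pow_right_of_lt_one₀ (by norm_num) (by norm_num) hx
    linarith
end

section
/- For integers ℓ ≥ 1 and k ≥ 2, and for each j ∈ {0,1,...,k-1}, the number of sequences r = r_0, r_1, ..., r_{ℓ-1} with entries in {0,1,...,k-1} that contain 0,1,...,j-1 as a subsequence but do not contain 0,1,...,j as a subsequence equals C(ℓ,j)·(k-1)^{ℓ-j}. -/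
/-- The sequence `r : Fin ℓ → Fin k` contains `0, 1, …, j-1` as a subsequence. -/
def ContainsInit {ℓ k : ℕ} (r : Fin ℓ → Fin k) (j : ℕ) : Prop :=
  ∃ i : Fin j → Fin ℓ, StrictMono i ∧ ∀ h : Fin j, (r (i h) : ℕ) = (h : ℕ)

namespace ContainsInit

variable {ℓ k : ℕ}

theorem zero (r : Fin ℓ → Fin k) : ContainsInit r 0 :=
  ⟨Fin.elim0, fun a => a.elim0, fun a => a.elim0⟩

theorem of_succ {r : Fin ℓ → Fin k} {j : ℕ} (h : ContainsInit r (j + 1)) : ContainsInit r j := by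
  obtain ⟨i, hi, hr⟩ := h
  exact ⟨fun x => i x.castSucc, hi.comp Fin.strictMono_castSucc, fun x => hr x.castSucc⟩

theorem not_succ_of_length_zero (r : Fin 0 → Fin k) (j : ℕ) : ¬ ContainsInit r (j + 1) :=
  fun ⟨i, _, _⟩ => (i 0).elim0

/-- Witnesses that avoid the last position of a sequence are witnesses for its initial part. -/
theorem of_snoc {r : Fin ℓ → Fin k} {a : Fin k} {j : ℕ} (i : Fin j → Fin (ℓ + 1))
    (hi : StrictMono i) (hr : ∀ h, (Fin.snoc (α := fun _ => Fin k) r a (i h) : ℕ) = h)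
    (hlast : ∀ h, i h ≠ Fin.last ℓ) : ContainsInit r j := by
  refine ⟨fun h => (i h).castPred (hlast h), fun x y hxy => ?_, fun h => ?_⟩
  · exact Fin.castPred_lt_castPred (hi hxy) (hlast y)
  · rw [← hr h]
    conv_rhs => rw [← Fin.castSucc_castPred (i h) (hlast h)]
    rw [Fin.snoc_castSucc]

theorem snoc_succ_iff (r : Fin ℓ → Fin k) (a : Fin k) (j : ℕ) :
    ContainsInit (Fin.snoc (α := fun _ => Fin k) r a) (j + 1) ↔
      ContainsInit r (j + 1) ∨ ContainsInit r j ∧ (a : ℕ) = j := by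
  constructor
  · rintro ⟨i, hi, hr⟩
    by_cases hl : i (Fin.last j) = Fin.last ℓ
    · refine Or.inr ⟨of_snoc (fun x => i x.castSucc) (hi.comp Fin.strictMono_castSucc)
        (fun h => hr h.castSucc) (fun h => ?_), ?_⟩
      · exact ((hi (Fin.castSucc_lt_last h)).trans_le (Fin.le_last _)).ne
      · have := hr (Fin.last j)
        rwa [hl, Fin.snoc_last, Fin.val_last] at this
    · refine Or.inl (of_snoc i hi hr fun h hh => hl ?_)
      exact le_antisymm (Fin.le_last _) (hh ▸ hi.monotone (Fin.le_last h))
  · rintro (⟨i, hi, hr⟩ | ⟨⟨i, hi, hr⟩, ha⟩)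
    · refine ⟨fun h => (i h).castSucc, Fin.strictMono_castSucc.comp hi, fun h => ?_⟩
      rw [Fin.snoc_castSucc, hr]
    · refine ⟨Fin.snoc (α := fun _ => Fin (ℓ + 1)) (fun h => (i h).castSucc) (Fin.last ℓ),
        fun x y hxy => ?_, fun h => ?_⟩
      · induction y using Fin.lastCases with
        | last =>
          induction x using Fin.lastCases with
          | last => exact absurd hxy (lt_irrefl _)
          | cast x =>
            rw [Fin.snoc_castSucc, Fin.snoc_last]
            exact Fin.castSucc_lt_last _
        | cast y =>
          induction x using Fin.lastCases with
          | last => exact absurd hxy (Fin.le_last _).not_gt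
          | cast x =>
            rw [Fin.snoc_castSucc, Fin.snoc_castSucc]
            exact Fin.castSucc_lt_castSucc_iff.2 (hi (Fin.castSucc_lt_castSucc_iff.1 hxy))
      · induction h using Fin.lastCases with
        | last => rw [Fin.snoc_last, Fin.snoc_last, ha, Fin.val_last]
        | cast h => rw [Fin.snoc_castSucc, Fin.snoc_castSucc, hr, Fin.val_castSucc]

end ContainsInit

theorem card_snoc_ne_or_eq {ℓ k : ℕ} (P Q : (Fin ℓ → Fin k) → Prop)
    (R : (Fin (ℓ + 1) → Fin k) → Prop) (c d : Fin k) (hPQ : ∀ r, P r → ¬ Q r)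
    (hR : ∀ r a, R (Fin.snoc (α := fun _ => Fin k) r a) ↔ P r ∧ a ≠ c ∨ Q r ∧ a = d) :
    Nat.card {r // R r} = (k - 1) * Nat.card {r // P r} + Nat.card {r // Q r} := by
  have e : {r // R r} ≃ ↥(({c}ᶜ ×ˢ {r | P r} ∪ {d} ×ˢ {r | Q r} : Set (Fin k × (Fin ℓ → Fin k)))) :=
    ((Fin.snocEquiv fun _ => Fin k).subtypeEquiv fun p => by
      have := hR p.2 p.1
      simp only [Set.mem_union, Set.mem_prod, Set.mem_compl_iff, Set.mem_singleton_iff,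
        Set.mem_ofPred_eq]
      rw [and_comm, and_comm (b := Q p.2)]
      exact this.symm).symm
  rw [Nat.card_congr e, Nat.card_coe_set_eq, Set.ncard_union_eq, Set.ncard_prod, Set.ncard_prod,
    Set.ncard_compl, Set.ncard_singleton, Set.ncard_singleton, Nat.card_fin, one_mul]
  · rfl
  · exact Set.disjoint_left.2 fun p hp hq => hPQ p.2 hp.2 hq.2

theorem card_containsInit_not_succ (ℓ k j : ℕ) (hj : j < k) :
    Nat.card {r : Fin ℓ → Fin k // ContainsInit r j ∧ ¬ ContainsInit r (j + 1)} =
      ℓ.choose j * (k - 1) ^ (ℓ - j) := by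
  induction ℓ generalizing j with
  | zero =>
    cases j with
    | zero => simp [ContainsInit.zero, ContainsInit.not_succ_of_length_zero]
    | succ j => simp [ContainsInit.not_succ_of_length_zero]
  | succ ℓ ih =>
    cases j with
    | zero =>
      rw [card_snoc_ne_or_eq (fun r => ContainsInit r 0 ∧ ¬ ContainsInit r (0 + 1))
        (fun _ => False) _ ⟨0, hj⟩ ⟨0, hj⟩ (fun _ _ h => h), ih 0 hj]
      · simp [pow_succ, mul_comm]
      · intro r a
        rw [ContainsInit.snoc_succ_iff]
        simp [ContainsInit.zero, Fin.ext_iff]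
    | succ j =>
      rw [card_snoc_ne_or_eq (fun r => ContainsInit r (j + 1) ∧ ¬ ContainsInit r (j + 1 + 1))
        (fun r => ContainsInit r j ∧ ¬ ContainsInit r (j + 1)) _ ⟨j + 1, hj⟩ ⟨j, by omega⟩
        (fun _ h h' => h'.2 h.1), ih _ hj, ih j (by omega)]
      · rw [Nat.choose_succ_succ, Nat.add_sub_add_right]
        rcases lt_or_ge j ℓ with h | h
        · obtain ⟨m, rfl⟩ := Nat.exists_eq_add_of_lt h
          rw [show j + m + 1 - (j + 1) = m by omega, show j + m + 1 - j = m + 1 by omega]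
          ring
        · rw [Nat.choose_eq_zero_of_lt (show ℓ < j + 1 by omega)]
          ring
      · intro r a
        rw [ContainsInit.snoc_succ_iff, ContainsInit.snoc_succ_iff, Ne, Fin.ext_iff, Fin.ext_iff]
        have h₁ := ContainsInit.of_succ (r := r) (j := j)
        have h₂ := ContainsInit.of_succ (r := r) (j := j + 1)
        have h₃ : (a : ℕ) = j → (a : ℕ) ≠ j + 1 := by omega
        tauto

theorem count_contains_j_not_j_succ (ℓ k j : ℕ) (hℓ : 1 ≤ ℓ) (hk : 2 ≤ k) (hj : j < k) :
    Nat.card {r : Fin ℓ → Fin k // ContainsInit r j ∧ ¬ ContainsInit r (j + 1)} =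
      ℓ.choose j * (k - 1) ^ (ℓ - j) :=
  card_containsInit_not_succ ℓ k j hj
end

section
/- For integers ℓ ≥ 1 and k ≥ 2, the number of sequences r = r_0, r_1, ..., r_{ℓ-1} with entries in {0,1,...,k-1} that do not contain the sequence 0,1,...,k-1 as a subsequence equals the sum over j = 0 to k-1 of C(ℓ,j)·(k-1)^{ℓ-j}. Equivalently, if r is chosen uniformly at random among all k^ℓ such sequences, the probability p_{ℓ,k} that r does not contain 0,1,...,k-1 as a subsequence equals (1/k^ℓ)·Σ_{j=0}^{k-1} C(ℓ,j)·(k-1)^{ℓ-j}. -/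
/-- Pascal-type recurrence for truncated binomial sums. -/
theorem sum_range_succ_choose_mul_pow (q n m : ℕ) :
    ∑ i ∈ Finset.range (m + 1), (n + 1).choose i * q ^ (n + 1 - i) =
      ∑ i ∈ Finset.range m, n.choose i * q ^ (n - i) +
        q * ∑ i ∈ Finset.range (m + 1), n.choose i * q ^ (n - i) := by
  have key : ∀ i, (n + 1).choose (i + 1) * q ^ (n + 1 - (i + 1)) =
      n.choose i * q ^ (n - i) + q * (n.choose (i + 1) * q ^ (n - (i + 1))) := by
    intro i
    rw [Nat.choose_succ_succ, Nat.add_sub_add_right, add_mul]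
    congr 1
    rcases Nat.lt_or_ge i n with h | h
    · rw [show n - i = n - (i + 1) + 1 by omega, pow_succ]
      ring
    · simp [Nat.choose_eq_zero_of_lt (show n < i + 1 by omega)]
  rw [Finset.sum_range_succ', Finset.sum_range_succ' _ m, mul_add, Finset.mul_sum,
    Finset.sum_congr rfl fun i _ => key i, Finset.sum_add_distrib]
  simp [pow_succ]
  ring

/-- The number of words of length `n` avoiding a given word `a` as a subsequence depends only on
the length of `a`. -/
theorem card_not_sublist_ofFn {α : Type*} [Fintype α] [DecidableEq α] (n : ℕ) (a : List α) :
    ∑ r : Fin n → α, (if a.Sublist (List.ofFn r) then 0 else 1) =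
      ∑ i ∈ Finset.range a.length, n.choose i * (Fintype.card α - 1) ^ (n - i) := by
  induction n generalizing a with
  | zero =>
    cases a with
    | nil => simp
    | cons x b => simp [Finset.sum_range_succ']
  | succ n ih =>
    cases a with
    | nil => simp
    | cons x b =>
      rw [List.length_cons, sum_range_succ_choose_mul_pow, ← ih b, ← List.length_cons (a := x),
        ← ih (x :: b), ← (Fin.consEquiv fun _ => α).sum_comp, Fintype.sum_prod_type,
        Fintype.sum_eq_add_sum_compl x]
      congr 1
      · simp [Fin.consEquiv, List.ofFn_succ]
      · rw [Finset.sum_congr rfl (g := fun _ => ∑ r : Fin n → α,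
          (if (x :: b).Sublist (List.ofFn r) then 0 else 1))]
        · simp [Finset.card_compl]
        · intro y hy
          have hxy : x ≠ y := by simpa [eq_comm] using hy
          refine Finset.sum_congr rfl fun r _ => ?_
          simp [Fin.consEquiv, List.ofFn_succ, List.sublist_cons_iff, hxy]

theorem containsInit_iff_finRange_sublist {ℓ k : ℕ} (r : Fin ℓ → Fin k) :
    ContainsInit r k ↔ (List.finRange k).Sublist (List.ofFn r) := by
  rw [List.sublist_iff_exists_fin_orderEmbedding_get_eq]
  constructor
  · rintro ⟨i, hi, h⟩
    refine ⟨OrderEmbedding.ofStrictMono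
      (fun x => Fin.cast (by simp) (i (Fin.cast (by simp) x))) fun x y hxy => ?_, fun x => ?_⟩
    · exact hi hxy
    · ext
      simp only [List.get_eq_getElem, List.getElem_finRange, List.getElem_ofFn]
      exact (h (Fin.cast (by simp) x)).symm
  · rintro ⟨f, hf⟩
    refine ⟨fun x => Fin.cast (by simp) (f (Fin.cast (by simp) x)), fun x y hxy => ?_,
      fun x => ?_⟩
    · exact f.strictMono hxy
    · have := hf (Fin.cast (by simp) x)
      simp only [List.get_eq_getElem, List.getElem_finRange, List.getElem_ofFn] at this
      exact congrArg Fin.val this.symm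

theorem count_not_containing_full_increasing_run (ℓ k : ℕ) (hℓ : 1 ≤ ℓ) (hk : 2 ≤ k) :
    Nat.card {r : Fin ℓ → Fin k // ¬ ContainsInit r k} =
      ∑ j ∈ Finset.range k, ℓ.choose j * (k - 1) ^ (ℓ - j) ∧
    (Nat.card {r : Fin ℓ → Fin k // ¬ ContainsInit r k} : ℝ) / (k : ℝ) ^ ℓ =
      (1 / (k : ℝ) ^ ℓ) *
        ∑ j ∈ Finset.range k, (ℓ.choose j : ℝ) * ((k : ℝ) - 1) ^ (ℓ - j) := by
  have hcard : Nat.card {r : Fin ℓ → Fin k // ¬ ContainsInit r k} =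
      ∑ j ∈ Finset.range k, ℓ.choose j * (k - 1) ^ (ℓ - j) := by
    have h := card_not_sublist_ofFn ℓ (List.finRange k)
    rw [List.length_finRange, Fintype.card_fin] at h
    simp_rw [containsInit_iff_finRange_sublist]
    rw [← h, Nat.card_eq_fintype_card, Fintype.card_subtype, Finset.card_filter]
    simp only [ite_not]
  refine ⟨hcard, ?_⟩
  rw [hcard, div_eq_mul_one_div, mul_comm]
  push_cast [Nat.cast_sub (show 1 ≤ k by omega)]
  rfl
end

section
/- For integers ℓ ≥ k ≥ 2, the following inequality holds: Σ_{j=0}^{k-1} C(ℓ,j)·(k-1)^{-j} ≤ (2ℓ/k)^k. -/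
/-- Truncated binomial sums are bounded by rescaling the variable: for `1 ≤ x` and `0 < p`,
the first `k` terms of `(1 + 1 / p) ^ ℓ` add up to at most `x ^ k * (1 + 1 / (p * x)) ^ ℓ`. -/
theorem sum_range_choose_div_pow_le_pow_mul {ℓ k : ℕ} (hℓ : k ≤ ℓ) {p x : ℝ} (hp : 0 < p)
    (hx : 1 ≤ x) :
    ∑ j ∈ Finset.range k, (ℓ.choose j : ℝ) / p ^ j ≤ x ^ k * (1 / (p * x) + 1) ^ ℓ := by
  have hx0 : 0 < x := zero_lt_one.trans_le hx
  rw [add_pow, Finset.mul_sum]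
  calc ∑ j ∈ Finset.range k, (ℓ.choose j : ℝ) / p ^ j
      ≤ ∑ j ∈ Finset.range k, x ^ k * ((1 / (p * x)) ^ j * 1 ^ (ℓ - j) * ℓ.choose j) := by
        refine Finset.sum_le_sum fun j hj => ?_
        have hpow : x ^ j ≤ x ^ k := pow_le_pow_right₀ hx (Finset.mem_range.mp hj).le
        calc (ℓ.choose j : ℝ) / p ^ j = x ^ j * (ℓ.choose j / (p ^ j * x ^ j)) := by
              field_simp
          _ ≤ x ^ k * (ℓ.choose j / (p ^ j * x ^ j)) := by gcongr
          _ = x ^ k * ((1 / (p * x)) ^ j * 1 ^ (ℓ - j) * ℓ.choose j) := by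
              rw [one_pow, div_pow, one_pow, mul_pow]
              ring
    _ ≤ _ := Finset.sum_le_sum_of_subset_of_nonneg
        (Finset.range_mono (by lia)) fun _ _ _ => by positivity

theorem sum_binom_div_pow_le (ℓ k : ℕ) (hk : 2 ≤ k) (hℓ : k ≤ ℓ) :
    ∑ j ∈ Finset.range k, (ℓ.choose j : ℝ) / ((k : ℝ) - 1) ^ j ≤
      (2 * (ℓ : ℝ) / (k : ℝ)) ^ k := by
  have hℓk : (k : ℝ) ≤ ℓ := by exact_mod_cast hℓ
  rcases hk.eq_or_lt with rfl | hk3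
  · push_cast at hℓk
    norm_num [Finset.sum_range_succ]
    nlinarith
  have hk3' : (3 : ℝ) ≤ k := by exact_mod_cast hk3
  have hp : (0 : ℝ) < k - 1 := by linarith
  have hk0 : (0 : ℝ) < k := by linarith
  have hℓ0 : (0 : ℝ) < ℓ := by linarith
  have hexp : (1 / (((k : ℝ) - 1) * (ℓ / k)) + 1) ^ ℓ ≤ 2 ^ k :=
    calc (1 / (((k : ℝ) - 1) * (ℓ / k)) + 1) ^ ℓ
        ≤ Real.exp (1 / (((k : ℝ) - 1) * (ℓ / k))) ^ ℓ := by
          gcongr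
          exact Real.add_one_le_exp _
      _ = Real.exp (k / (k - 1)) := by
          rw [← Real.exp_nat_mul]
          congr 1
          field_simp
      _ ≤ Real.exp 2 := by
          gcongr
          rw [div_le_iff₀ hp]
          linarith
      _ = Real.exp 1 ^ 2 := by rw [← Real.exp_nat_mul]; norm_num
      _ ≤ 2 ^ 3 := by nlinarith [Real.exp_one_lt_d9, Real.exp_pos 1]
      _ ≤ 2 ^ k := pow_le_pow_right₀ one_le_two hk3
  calc _ ≤ ((ℓ : ℝ) / k) ^ k * (1 / (((k : ℝ) - 1) * (ℓ / k)) + 1) ^ ℓ :=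
        sum_range_choose_div_pow_le_pow_mul hℓ hp ((one_le_div hk0).mpr hℓk)
    _ ≤ ((ℓ : ℝ) / k) ^ k * 2 ^ k := by gcongr
    _ = _ := by rw [← mul_pow]; ring
end

section
/- For integers ℓ ≥ k ≥ 2, the probability p_{ℓ,k} that a uniformly random sequence r = r_0, r_1, ..., r_{ℓ-1} with entries in {0,1,...,k-1} does not contain 0,1,...,k-1 as a subsequence satisfies p_{ℓ,k} ≤ e^{-ℓ/k}·(2ℓ/k)^k. Equivalently, the number of such sequences not containing 0,1,...,k-1 as a subsequence is at most k^ℓ·e^{-ℓ/k}·(2ℓ/k)^k. -/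
theorem ContainsInit.of_init {ℓ k j : ℕ} {r : Fin (ℓ + 1) → Fin k}
    (h : ContainsInit (fun i : Fin ℓ => r i.castSucc) j) : ContainsInit r j := by
  obtain ⟨i, hi, hr⟩ := h
  exact ⟨fun x => (i x).castSucc, fun a b hab => Fin.castSucc_lt_castSucc_iff.mpr (hi hab), hr⟩

theorem ContainsInit.succ_of_init {ℓ k j : ℕ} {r : Fin (ℓ + 1) → Fin k}
    (h : ContainsInit (fun i : Fin ℓ => r i.castSucc) j) (hlast : (r (Fin.last ℓ) : ℕ) = j) :
    ContainsInit r (j + 1) := by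
  obtain ⟨i, hi, hr⟩ := h
  refine ⟨Fin.snoc (α := fun _ => Fin (ℓ + 1)) (fun x => (i x).castSucc) (Fin.last ℓ), ?_, ?_⟩
  · intro a b hab
    induction b using Fin.lastCases with
    | last =>
      induction a using Fin.lastCases with
      | last => exact absurd hab (lt_irrefl _)
      | cast a => simp
    | cast b =>
      induction a using Fin.lastCases with
      | last => exact absurd hab (not_lt.mpr (Fin.le_last _))
      | cast a => simpa using hi (Fin.castSucc_lt_castSucc_iff.mp hab)
  · intro x
    induction x using Fin.lastCases with
    | last => simpa using hlast
    | cast x => simpa using hr x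

theorem containsInit_zero {ℓ k : ℕ} (r : Fin ℓ → Fin k) : ContainsInit r 0 :=
  ⟨Fin.elim0, fun a => a.elim0, fun a => a.elim0⟩

/-- Splitting off the last letter bounds the number of sequences avoiding `0, …, j`. -/
theorem card_not_containsInit_succ_le (ℓ k j : ℕ) (hj : j < k) :
    Nat.card {r : Fin (ℓ + 1) → Fin k // ¬ ContainsInit r (j + 1)} ≤
      Nat.card {r : Fin ℓ → Fin k // ¬ ContainsInit r j} +
        (k - 1) * Nat.card {r : Fin ℓ → Fin k // ¬ ContainsInit r (j + 1)} := by
  classical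
  have hcard : Nat.card {a : Fin k // a ≠ ⟨j, hj⟩} = k - 1 := by
    rw [Nat.card_eq_fintype_card, Fintype.card_subtype_compl]
    simp
  rw [← hcard, ← Nat.card_prod, ← Nat.card_sum]
  let f : {r : Fin (ℓ + 1) → Fin k // ¬ ContainsInit r (j + 1)} →
      {r : Fin ℓ → Fin k // ¬ ContainsInit r j} ⊕
        {a : Fin k // a ≠ ⟨j, hj⟩} × {r : Fin ℓ → Fin k // ¬ ContainsInit r (j + 1)} :=
    fun r => if h : r.1 (Fin.last ℓ) = ⟨j, hj⟩ then
      Sum.inl ⟨fun i => r.1 i.castSucc, fun hc => r.2 (hc.succ_of_init (by simp [h]))⟩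
    else
      Sum.inr (⟨r.1 (Fin.last ℓ), h⟩, ⟨fun i => r.1 i.castSucc, fun hc => r.2 hc.of_init⟩)
  refine Nat.card_le_card_of_injective f fun r s hrs => ?_
  have key : (∀ i : Fin ℓ, r.1 i.castSucc = s.1 i.castSucc) ∧
      r.1 (Fin.last ℓ) = s.1 (Fin.last ℓ) := by
    by_cases hr : r.1 (Fin.last ℓ) = ⟨j, hj⟩ <;> by_cases hs : s.1 (Fin.last ℓ) = ⟨j, hj⟩ <;>
      simp only [f, hr, hs, dif_pos, dif_neg, not_false_eq_true, reduceCtorEq, Sum.inl.injEq,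
        Sum.inr.injEq, Prod.mk.injEq, Subtype.mk.injEq] at hrs
    · exact ⟨congrFun hrs, hr.trans hs.symm⟩
    · exact ⟨congrFun hrs.2, hrs.1⟩
  ext x : 2
  induction x using Fin.lastCases with
  | last => exact key.2
  | cast x => exact key.1 x

/-- A Chernoff-type bound for the number of sequences avoiding `0, …, j - 1`. -/
theorem card_not_containsInit_mul_pow_le (k : ℕ) (hk : 1 ≤ k) {t : ℝ} (ht0 : 0 ≤ t) (ht1 : t ≤ 1)
    (ℓ j : ℕ) (hj : j ≤ k) :
    (Nat.card {r : Fin ℓ → Fin k // ¬ ContainsInit r j} : ℝ) * t ^ j ≤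
      t * ((k : ℝ) - 1 + t) ^ ℓ := by
  induction ℓ generalizing j with
  | zero =>
    cases j with
    | zero => simpa [containsInit_zero] using ht0
    | succ j =>
      have h1 : Nat.card {r : Fin 0 → Fin k // ¬ ContainsInit r (j + 1)} ≤ 1 :=
        Finite.card_le_one_iff_subsingleton.mpr inferInstance
      have h2 : (Nat.card {r : Fin 0 → Fin k // ¬ ContainsInit r (j + 1)} : ℝ) ≤ 1 := by
        exact_mod_cast h1
      calc _ ≤ 1 * t ^ (j + 1) := by gcongr
        _ ≤ t * ((k : ℝ) - 1 + t) ^ 0 := by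
          rw [one_mul, pow_zero, mul_one]
          exact pow_le_of_le_one ht0 ht1 j.succ_ne_zero
  | succ ℓ ih =>
    cases j with
    | zero =>
      have hk' : (1 : ℝ) ≤ k := by exact_mod_cast hk
      have : 0 ≤ (k : ℝ) - 1 + t := by linarith
      simpa [containsInit_zero] using mul_nonneg ht0 (pow_nonneg this (ℓ + 1))
    | succ j =>
      have hk' : (0 : ℝ) ≤ (k : ℝ) - 1 := by
        have : (1 : ℝ) ≤ k := by exact_mod_cast hk
        linarith
      have h := card_not_containsInit_succ_le ℓ k j hj
      have h' : (Nat.card {r : Fin (ℓ + 1) → Fin k // ¬ ContainsInit r (j + 1)} : ℝ) ≤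
          Nat.card {r : Fin ℓ → Fin k // ¬ ContainsInit r j} +
            ((k : ℝ) - 1) * Nat.card {r : Fin ℓ → Fin k // ¬ ContainsInit r (j + 1)} := by
        have e : ((k - 1 : ℕ) : ℝ) = (k : ℝ) - 1 := by rw [Nat.cast_sub hk, Nat.cast_one]
        rw [← e]
        exact_mod_cast h
      have i1 := mul_le_mul_of_nonneg_left (ih j (by omega)) ht0
      have i2 := mul_le_mul_of_nonneg_left (ih (j + 1) hj) hk'
      have i3 := mul_le_mul_of_nonneg_right h' (pow_nonneg ht0 (j + 1))
      refine i3.trans ?_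
      rw [pow_succ ((k : ℝ) - 1 + t)]
      rw [pow_succ t] at i2 ⊢
      linarith

theorem prob_not_containing_full_run_le (ℓ k : ℕ) (hk : 2 ≤ k) (hℓ : k ≤ ℓ) :
    (Nat.card {r : Fin ℓ → Fin k // ¬ ContainsInit r k} : ℝ) / (k : ℝ) ^ ℓ ≤
      Real.exp (-(ℓ : ℝ) / (k : ℝ)) * (2 * (ℓ : ℝ) / (k : ℝ)) ^ k ∧
    (Nat.card {r : Fin ℓ → Fin k // ¬ ContainsInit r k} : ℝ) ≤
      (k : ℝ) ^ ℓ * Real.exp (-(ℓ : ℝ) / (k : ℝ)) * (2 * (ℓ : ℝ) / (k : ℝ)) ^ k := by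
  have hk0 : (0 : ℝ) < k := by exact_mod_cast (by omega : 0 < k)
  have hk1 : (1 : ℝ) ≤ k := by exact_mod_cast (by omega : 1 ≤ k)
  have hℓ0 : (0 : ℝ) < ℓ := by exact_mod_cast (by omega : 0 < ℓ)
  have hcount : (Nat.card {r : Fin ℓ → Fin k // ¬ ContainsInit r k} : ℝ) ≤
      (k : ℝ) ^ ℓ * Real.exp (-(ℓ : ℝ) / (k : ℝ)) * (2 * (ℓ : ℝ) / (k : ℝ)) ^ k := by
    obtain ⟨t, ht⟩ : ∃ t : ℝ, t = (k : ℝ) / ℓ := ⟨_, rfl⟩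
    have ht0 : 0 < t := by rw [ht]; positivity
    have ht1 : t ≤ 1 := by
      rw [ht, div_le_one hℓ0]
      exact_mod_cast hℓ
    have hbase : (k : ℝ) - 1 + t ≤ k * Real.exp (-(1 - t) / k) := by
      have h := mul_le_mul_of_nonneg_left (Real.add_one_le_exp (-(1 - t) / k)) hk0.le
      have e : (k : ℝ) * (-(1 - t) / k + 1) = k - 1 + t := by field_simp; ring
      rwa [e] at h
    have hpow : ((k : ℝ) - 1 + t) ^ ℓ ≤
        (k : ℝ) ^ ℓ * (Real.exp (-(ℓ : ℝ) / k) * Real.exp 1) := by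
      refine (pow_le_pow_left₀ (by linarith) hbase ℓ).trans_eq ?_
      rw [mul_pow, ← Real.exp_nat_mul, ← Real.exp_add]
      congr 2
      rw [ht]
      field_simp
      ring
    have hexp : t * Real.exp 1 ≤ 2 ^ k := by
      have h4 : (2 : ℝ) ^ 2 ≤ 2 ^ k := pow_le_pow_right₀ one_le_two hk
      have h3 := Real.exp_one_lt_three
      have := mul_le_mul_of_nonneg_right ht1 (Real.exp_pos 1).le
      linarith
    have hmul : (2 * (ℓ : ℝ) / k) ^ k * t ^ k = 2 ^ k := by
      rw [← mul_pow, ht]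
      congr 1
      field_simp
    refine le_of_mul_le_mul_right ?_ (pow_pos ht0 k)
    calc _ ≤ t * ((k : ℝ) - 1 + t) ^ ℓ :=
          card_not_containsInit_mul_pow_le k (by omega) ht0.le ht1 ℓ k le_rfl
      _ ≤ t * ((k : ℝ) ^ ℓ * (Real.exp (-(ℓ : ℝ) / k) * Real.exp 1)) := by gcongr
      _ = (k : ℝ) ^ ℓ * Real.exp (-(ℓ : ℝ) / k) * (t * Real.exp 1) := by ring
      _ ≤ (k : ℝ) ^ ℓ * Real.exp (-(ℓ : ℝ) / k) * 2 ^ k := by gcongr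
      _ = _ := by rw [mul_assoc _ _ (t ^ k), hmul]
  refine ⟨?_, hcount⟩
  rw [div_le_iff₀ (pow_pos hk0 ℓ)]
  linarith
end

section
/- There exists a constant β with 0 < β < 1 such that the following holds. Fix integers N ≥ 2, k with 2 ≤ k ≤ N, and m ≥ 2k. Let S̄ = S_0, S_1, ..., S_{m-1} be random subsets of {0,1,...,N-1}, where each element of {0,1,...,N-1} is included in each S_i independently with probability 1/k (independently across all i and all elements). Then for every X ⊆ {0,1,...,N-1} with |X| = k and every enumeration x_1, x_2, ..., x_k of X, the probability that there do NOT exist indices 0 ≤ i_1 < i_2 < ... < i_k ≤ m-1 with S_{i_l} ∩ X = {x_l} for all l = 1,...,k is at most β^{m/k}·(m/k)^k. -/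
/-- The probability weight of the sequence of subsets `S 0, …, S (m-1)` of `{0,…,N-1}`
under the product measure in which each element belongs to each `S i` independently
with probability `1/k`. -/
noncomputable def seqWeight (N k m : ℕ) (S : Fin m → Finset (Fin N)) : ℝ :=
  ∏ i : Fin m, (1 / (k : ℝ)) ^ (S i).card * (1 - 1 / (k : ℝ)) ^ (N - (S i).card)

/-- `S` isolates `X` in the order given by the enumeration `x`. -/
def IsolatesInOrder {N k m : ℕ} (S : Fin m → Finset (Fin N)) (X : Finset (Fin N))
    (x : Fin k → Fin N) : Prop :=
  ∃ i : Fin k → Fin m, StrictMono i ∧ ∀ l : Fin k, S (i l) ∩ X = {x l}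

open Classical in
/-- A generating-function tail bound: if each event `A l` has weight `p`, the weight of the sequences
of length `m` in which `A 0, …, A (r-1)` do not occur in this order is at most
`z⁻ʳ (1 - p + p z)ᵐ`, for every `0 < z ≤ 1`. -/
theorem sum_not_exists_strictMono_le {α : Type*} [Fintype α] (w : α → ℝ)
    (hw : ∀ a, 0 ≤ w a) (hw1 : ∑ a, w a = 1) {p z : ℝ} (hp0 : 0 ≤ p) (hp1 : p ≤ 1)
    (hz0 : 0 < z) (hz1 : z ≤ 1) (m : ℕ) :
    ∀ (r : ℕ) (A : Fin r → Set α), (∀ l, ∑ a ∈ Finset.univ.filter (· ∈ A l), w a = p) →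
      ∑ S ∈ Finset.univ.filter (fun S : Fin m → α =>
          ¬ ∃ i : Fin r → Fin m, StrictMono i ∧ ∀ l, S (i l) ∈ A l), ∏ i, w (S i) ≤
        z⁻¹ ^ r * (1 - p + p * z) ^ m := by
  have hq : 0 ≤ 1 - p + p * z := by
    have := mul_nonneg hp0 hz0.le
    linarith
  induction m with
  | zero =>
    intro r A _
    calc _ ≤ ∑ S : Fin 0 → α, ∏ i, w (S i) :=
          Finset.sum_le_sum_of_subset_of_nonneg (Finset.filter_subset _ _)
            fun S _ _ => Finset.prod_nonneg fun i _ => hw _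
      _ = 1 := by simp
      _ ≤ _ := by simpa using one_le_pow₀ ((one_le_inv₀ hz0).2 hz1)
  | succ m ih =>
    intro r A hA
    cases r with
    | zero =>
      rw [Finset.sum_eq_zero]
      · positivity
      · intro S hS
        exact absurd ⟨Fin.elim0, fun a => a.elim0, fun l => l.elim0⟩ (Finset.mem_filter.1 hS).2
    | succ r =>
      have hfirst := ih r (fun l => A l.succ) (fun l => hA l.succ)
      have hall := ih (r + 1) A hA
      set B := z⁻¹ ^ r * (1 - p + p * z) ^ m with hB
      set C := z⁻¹ ^ (r + 1) * (1 - p + p * z) ^ m with hC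
      have hinner (s : α) : ∑ S : Fin m → α,
          (if ¬ ∃ i : Fin (r + 1) → Fin (m + 1), StrictMono i ∧
              ∀ l, (Fin.cons s S : Fin (m + 1) → α) (i l) ∈ A l then ∏ i, w (S i) else 0) ≤
          if s ∈ A 0 then B else C := by
        rw [← Finset.sum_filter]
        split_ifs with hs
        · refine le_trans (Finset.sum_le_sum_of_subset_of_nonneg ?_
            fun S _ _ => Finset.prod_nonneg fun i _ => hw _) hfirst
          intro S hS
          simp only [Finset.mem_filter, Finset.mem_univ, true_and] at hS ⊢
          rintro ⟨i, hi, hiA⟩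
          refine hS ⟨Fin.cons 0 (fun l => (i l).succ), ?_, ?_⟩
          · intro a b hab
            induction a using Fin.cases with
            | zero =>
              induction b using Fin.cases with
              | zero => exact absurd hab (lt_irrefl _)
              | succ b => simp
            | succ a =>
              induction b using Fin.cases with
              | zero => exact absurd hab (Fin.not_lt_zero _)
              | succ b => simpa using hi (Fin.succ_lt_succ_iff.1 hab)
          · intro l
            induction l using Fin.cases with
            | zero => simpa using hs
            | succ l => simpa using hiA l
        · refine le_trans (Finset.sum_le_sum_of_subset_of_nonneg ?_
            fun S _ _ => Finset.prod_nonneg fun i _ => hw _) hall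
          intro S hS
          simp only [Finset.mem_filter, Finset.mem_univ, true_and] at hS ⊢
          rintro ⟨i, hi, hiA⟩
          exact hS ⟨fun l => (i l).succ, fun a b hab => Fin.succ_lt_succ_iff.2 (hi hab),
            fun l => by simpa using hiA l⟩
      have hcompl : ∑ a ∈ Finset.univ.filter (fun a => ¬ a ∈ A 0), w a = 1 - p := by
        have := Finset.sum_filter_add_sum_filter_not Finset.univ (· ∈ A 0) w
        rw [hA 0, hw1] at this
        linarith
      calc _ = ∑ s, w s * ∑ S : Fin m → α,
            (if ¬ ∃ i : Fin (r + 1) → Fin (m + 1), StrictMono i ∧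
              ∀ l, (Fin.cons s S : Fin (m + 1) → α) (i l) ∈ A l then ∏ i, w (S i) else 0) := by
            rw [Finset.sum_filter, ← (Fin.consEquiv fun _ : Fin (m + 1) => α).sum_comp,
              Fintype.sum_prod_type]
            refine Finset.sum_congr rfl fun s _ => ?_
            rw [Finset.mul_sum]
            refine Finset.sum_congr rfl fun S _ => ?_
            rw [mul_ite, mul_zero]
            simp [Fin.consEquiv, Fin.prod_univ_succ]
        _ ≤ ∑ s, w s * (if s ∈ A 0 then B else C) :=
            Finset.sum_le_sum fun s _ => mul_le_mul_of_nonneg_left (hinner s) (hw s)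
        _ = p * B + (1 - p) * C := by
            simp only [mul_ite]
            rw [Finset.sum_ite, ← Finset.sum_mul, ← Finset.sum_mul, hA 0, hcompl]
        _ = _ := by
            rw [hB, hC]
            linear_combination -(p * z⁻¹ ^ r * (1 - p + p * z) ^ m) * mul_inv_cancel₀ hz0.ne'

theorem sum_weight_eq_one (n : ℕ) (q : ℝ) :
    ∑ S : Finset (Fin n), q ^ S.card * (1 - q) ^ (n - S.card) = 1 := by
  have := Finset.sum_pow_mul_eq_add_pow q (1 - q) (Finset.univ : Finset (Fin n))
  simpa using this

theorem sum_weight_inter_eq_singleton {n : ℕ} (q : ℝ) (X : Finset (Fin n)) {a : Fin n}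
    (ha : a ∈ X) :
    ∑ S ∈ Finset.univ.filter (fun S : Finset (Fin n) => S ∩ X = {a}),
      q ^ S.card * (1 - q) ^ (n - S.card) = q * (1 - q) ^ (X.card - 1) := by
  have hsum := Finset.sum_pow_mul_eq_add_pow q (1 - q) Xᶜ
  rw [add_sub_cancel, one_pow] at hsum
  have hX : 0 < X.card := Finset.card_pos.2 ⟨a, ha⟩
  have hXn : Xᶜ.card + X.card = n := by simp [Finset.card_compl_add_card]
  have hmul := congrArg (q * (1 - q) ^ (X.card - 1) * ·) hsum
  simp only [Finset.mul_sum, mul_one] at hmul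
  rw [← hmul]
  symm
  refine Finset.sum_bij' (fun T _ => insert a T) (fun S _ => S \ X) ?_ ?_ ?_ ?_ ?_
  · intro T hT
    have hT' : ∀ b ∈ T, b ∉ X := fun b hb => by simpa using Finset.mem_powerset.1 hT hb
    simp only [Finset.mem_filter, Finset.mem_univ, true_and]
    ext b
    simp only [Finset.mem_inter, Finset.mem_insert, Finset.mem_singleton]
    grind
  · intro S _
    simp only [Finset.mem_powerset]
    intro b
    simp
  · intro T hT
    have hT' : ∀ b ∈ T, b ∉ X := fun b hb => by simpa using Finset.mem_powerset.1 hT hb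
    ext b
    simp only [Finset.mem_sdiff, Finset.mem_insert]
    grind
  · intro S hS
    have hS' : ∀ b, b ∈ S ∩ X ↔ b = a := by
      simp [(Finset.mem_filter.1 hS).2]
    ext b
    have := hS' b
    simp only [Finset.mem_sdiff, Finset.mem_insert, Finset.mem_inter] at this ⊢
    grind
  · intro T hT
    have haT : a ∉ T := fun h => by simpa [ha] using Finset.mem_powerset.1 hT h
    have hcard := Finset.card_le_card (Finset.mem_powerset.1 hT)
    rw [Finset.card_insert_of_notMem haT,
      show n - (T.card + 1) = (X.card - 1) + (Xᶜ.card - T.card) by omega, pow_add]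
    ring

theorem exp_neg_one_le_one_sub_one_div_pow {k : ℕ} (hk : 2 ≤ k) :
    Real.exp (-1) ≤ (1 - 1 / (k : ℝ)) ^ (k - 1) := by
  obtain ⟨n, rfl⟩ : ∃ n, k = n + 1 := ⟨k - 1, by omega⟩
  have hn : (0 : ℝ) < n := by exact_mod_cast (by omega : 0 < n)
  have h : Real.exp (-(1 / (n : ℝ))) ≤ 1 - 1 / ((n + 1 : ℕ) : ℝ) := by
    rw [Real.exp_neg]
    have h1 := Real.add_one_le_exp (1 / (n : ℝ))
    calc _ ≤ (1 / (n : ℝ) + 1)⁻¹ := inv_anti₀ (by positivity) h1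
      _ = _ := by push_cast; field_simp; ring
  calc Real.exp (-1) = Real.exp (-(1 / (n : ℝ))) ^ n := by
        rw [← Real.exp_nat_mul]
        congr 1
        field_simp
    _ ≤ _ := by
        simpa using pow_le_pow_left₀ (Real.exp_pos _).le h n

open Classical in
theorem prob_not_isolating_in_order :
    ∃ β : ℝ, 0 < β ∧ β < 1 ∧
      ∀ N k m : ℕ, 2 ≤ N → 2 ≤ k → k ≤ N → 2 * k ≤ m →
        ∀ X : Finset (Fin N), X.card = k →
          ∀ x : Fin k → Fin N, Function.Injective x → X = Finset.image x Finset.univ →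
            (∑ S ∈ Finset.univ.filter
                (fun S : Fin m → Finset (Fin N) => ¬ IsolatesInOrder S X x),
              seqWeight N k m S) ≤
              β ^ ((m : ℝ) / (k : ℝ)) * ((m : ℝ) / (k : ℝ)) ^ k := by
  refine ⟨Real.exp (-(Real.exp (-1) / 2)), Real.exp_pos _, ?_, ?_⟩
  · rw [Real.exp_lt_one_iff]
    have := Real.exp_pos (-1)
    linarith
  intro N k m _ hk _ hm X hX x _ hxX
  have hk0 : (0 : ℝ) < k := by exact_mod_cast (by omega : 0 < k)
  have hm0 : (0 : ℝ) < m := by exact_mod_cast (by omega : 0 < m)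
  have hmk : 2 * (k : ℝ) ≤ m := by exact_mod_cast hm
  have hq1 : 1 / (k : ℝ) ≤ 1 := by
    rw [div_le_one hk0]
    exact_mod_cast (by omega : 1 ≤ k)
  have hq0 : 0 ≤ 1 - 1 / (k : ℝ) := by linarith
  set p : ℝ := 1 / (k : ℝ) * (1 - 1 / (k : ℝ)) ^ (k - 1) with hp
  have hp0 : 0 ≤ p := by positivity
  have hp1 : p ≤ 1 := mul_le_one₀ hq1 (by positivity)
    (pow_le_one₀ hq0 (by linarith [one_div_pos.2 hk0]))
  have hpe : Real.exp (-1) / k ≤ p := by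
    rw [hp, div_eq_mul_one_div, mul_comm]
    exact mul_le_mul_of_nonneg_left (exp_neg_one_le_one_sub_one_div_pow hk) (by positivity)
  have hz : (k : ℝ) / m ≤ 1 / 2 := by
    rw [div_le_div_iff₀ hm0 two_pos]
    linarith
  have hz0 : 0 < (k : ℝ) / m := by positivity
  have hbound := sum_not_exists_strictMono_le
    (fun S : Finset (Fin N) => (1 / (k : ℝ)) ^ S.card * (1 - 1 / (k : ℝ)) ^ (N - S.card))
    (fun S => by positivity) (sum_weight_eq_one N _) hp0 hp1 hz0 (by linarith) m k
    (fun l => {S | S ∩ X = {x l}}) (fun l => by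
      have := sum_weight_inter_eq_singleton (1 / (k : ℝ)) X (a := x l) (by simp [hxX])
      rw [hX] at this
      convert this using 2
      ext S
      simp)
  have hpow : (1 - p + p * (k / m)) ^ m ≤
      Real.exp (-(Real.exp (-1) / 2)) ^ ((m : ℝ) / (k : ℝ)) := by
    have hle : 1 - p + p * (k / m) ≤ Real.exp (-(Real.exp (-1) / (2 * k))) := by
      refine le_trans ?_ (Real.add_one_le_exp _)
      have h1 : p * (k / m) ≤ p * (1 / 2) := mul_le_mul_of_nonneg_left hz hp0
      have h2 : Real.exp (-1) / (2 * k) = Real.exp (-1) / k / 2 := by field_simp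
      linarith
    calc _ ≤ Real.exp (-(Real.exp (-1) / (2 * k))) ^ m :=
          pow_le_pow_left₀ (add_nonneg (by linarith) (by positivity)) hle m
      _ = _ := by
          rw [← Real.exp_nat_mul, ← Real.exp_mul]
          congr 1
          field_simp
  calc _ ≤ ((k : ℝ) / m)⁻¹ ^ k * (1 - p + p * (k / m)) ^ m := by
        convert hbound using 2
        · ext S
          simp [IsolatesInOrder]
        · rfl
    _ ≤ ((k : ℝ) / m)⁻¹ ^ k * Real.exp (-(Real.exp (-1) / 2)) ^ ((m : ℝ) / (k : ℝ)) :=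
        mul_le_mul_of_nonneg_left hpow (by positivity)
    _ = _ := by rw [inv_div, mul_comm]
end

section
/- Let β and c be real numbers with 0 < β < 1, c ≥ 1, and c·β^c < 1/16. Then for all integers N ≥ 2 and k with 2 ≤ k ≤ N, writing L = log₂ N, the following inequality holds: C(N,k)·k!·β^{c·k·L}·(c·k·L)^k < 1. -/
/-- One factor of the union bound: the per-element contribution is less than one. -/
theorem union_bound_factor_lt_one {β c : ℝ} (hβ0 : 0 < β) (hc : 1 ≤ c)
    (hcβ : c * β ^ c < 1 / 16) {N k : ℕ} (hN : 2 ≤ N) (hkN : k ≤ N) :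
    (N : ℝ) * (β ^ (c * Real.logb 2 N) * (c * (k : ℝ) * Real.logb 2 N)) < 1 := by
  have hN2 : (2 : ℝ) ≤ N := by exact_mod_cast hN
  have hN0 : (0 : ℝ) < N := by linarith
  have hk : (k : ℝ) ≤ N := by exact_mod_cast hkN
  have hpow : (2 : ℝ) ^ Real.logb 2 N = N :=
    Real.rpow_logb (by norm_num) (by norm_num) hN0
  have hL1 : 1 ≤ Real.logb 2 N := by
    rw [Real.le_logb_iff_rpow_le (by norm_num) hN0]
    simpa using hN2
  have hLN : Real.logb 2 N ≤ N := by
    rw [Real.logb_le_iff_le_rpow (by norm_num) hN0, Real.rpow_natCast]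
    exact_mod_cast Nat.lt_two_pow_self.le
  set L := Real.logb 2 N
  have hβc : 0 < β ^ c := Real.rpow_pos_of_pos hβ0 c
  have hdecay : c * β ^ (c * L) ≤ ((N : ℝ) ^ 4)⁻¹ := by
    calc c * β ^ (c * L) ≤ c ^ L * (β ^ c) ^ L := by
          rw [Real.rpow_mul hβ0.le]
          gcongr
          exact Real.self_le_rpow_of_one_le hc hL1
      _ = (c * β ^ c) ^ L := (Real.mul_rpow (by linarith) hβc.le).symm
      _ ≤ (((2 : ℝ) ^ 4)⁻¹) ^ L :=
          Real.rpow_le_rpow (by positivity) (by norm_num at hcβ ⊢; linarith) (by linarith)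
      _ = ((N : ℝ) ^ 4)⁻¹ := by
          rw [Real.inv_rpow (by norm_num), ← Real.rpow_pow_comm (by norm_num), hpow]
  calc (N : ℝ) * (β ^ (c * L) * (c * k * L)) = (c * β ^ (c * L)) * (N * k * L) := by ring
    _ ≤ ((N : ℝ) ^ 4)⁻¹ * (N * N * N) := by gcongr
    _ = (N : ℝ)⁻¹ := by field_simp
    _ < 1 := inv_lt_one_of_one_lt₀ (by linarith)

theorem union_bound_estimate (β c : ℝ) (hβ0 : 0 < β) (hβ1 : β < 1) (hc : 1 ≤ c)
    (hcβ : c * β ^ c < 1 / 16) (N k : ℕ) (hN : 2 ≤ N) (hk : 2 ≤ k) (hkN : k ≤ N) :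
    (N.choose k : ℝ) * (k.factorial : ℝ) *
        β ^ (c * (k : ℝ) * Real.logb 2 N) *
        (c * (k : ℝ) * Real.logb 2 N) ^ k < 1 := by
  have hL0 : 0 ≤ Real.logb 2 N :=
    Real.logb_nonneg (by norm_num) (by exact_mod_cast (by lia : 1 ≤ N))
  have hchoose : (N.choose k : ℝ) * (k.factorial : ℝ) ≤ (N : ℝ) ^ k := by
    rw [mul_comm]
    exact_mod_cast Nat.descFactorial_eq_factorial_mul_choose N k ▸ Nat.descFactorial_le_pow N k
  have hexp : β ^ (c * (k : ℝ) * Real.logb 2 N) = (β ^ (c * Real.logb 2 N)) ^ k := by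
    rw [← Real.rpow_mul_natCast hβ0.le, mul_right_comm]
  rw [hexp, mul_assoc, ← mul_pow]
  calc _ ≤ (N : ℝ) ^ k * (β ^ (c * Real.logb 2 N) * (c * (k : ℝ) * Real.logb 2 N)) ^ k := by
        gcongr
    _ = ((N : ℝ) * (β ^ (c * Real.logb 2 N) * (c * (k : ℝ) * Real.logb 2 N))) ^ k :=
        (mul_pow ..).symm
    _ < 1 := pow_lt_one₀ (by positivity) (union_bound_factor_lt_one hβ0 hc hcβ hN hkN) (by lia)
end

section
/- Let k ≥ 2 and q ≥ 2 be integers with q dividing k, let ℓ ≥ 1 be an integer, and partition {0,1,...,k-1} into the q blocks B_h = {h·(k/q), h·(k/q)+1, ..., (h+1)·(k/q)-1} for h = 0,1,...,q-1. For each j ∈ {0,1,...,q-1}, the number of sequences r = r_0, r_1, ..., r_{ℓ-1} with entries in {0,1,...,k-1} that contain a jump subsequence of length j but no jump subsequence of length j+1 equals C(ℓ,j)·(k/q)^j·(k - k/q)^{ℓ-j}. -/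
/-- With `{0,…,k-1}` partitioned into `q` consecutive blocks of size `k/q`
(block `B h = {h·(k/q), …, (h+1)·(k/q) - 1}`), the sequence `r : Fin ℓ → Fin k`
contains a jump subsequence of length `j`: indices `i 0 < i 1 < … < i (j-1)`
with `r (i h) ∈ B h` for every `h`. -/
def HasJumpSub {ℓ k : ℕ} (q : ℕ) (r : Fin ℓ → Fin k) (j : ℕ) : Prop :=
  ∃ i : Fin j → Fin ℓ, StrictMono i ∧
    ∀ h : Fin j, (h : ℕ) * (k / q) ≤ (r (i h) : ℕ) ∧
      (r (i h) : ℕ) < ((h : ℕ) + 1) * (k / q)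

/-- The `h`-th block of `k / q` consecutive elements of `Fin k`. -/
def jumpBlock (k q h : ℕ) : Set (Fin k) :=
  {x | h * (k / q) ≤ (x : ℕ) ∧ (x : ℕ) < (h + 1) * (k / q)}

/-- The sequences whose longest jump subsequence has length `j`. -/
def exactJumpSet (k q ℓ j : ℕ) : Set (Fin ℓ → Fin k) :=
  {r | HasJumpSub q r j ∧ ¬ HasJumpSub q r (j + 1)}

theorem ncard_jumpBlock {k q h : ℕ} (hh : h < q) :
    (jumpBlock k q h).ncard = k / q := by
  have hle : (h + 1) * (k / q) ≤ k :=
    (Nat.mul_le_mul_right _ hh).trans (Nat.mul_div_le k q)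
  have himage : Fin.val '' jumpBlock k q h =
      (Finset.Ico (h * (k / q)) ((h + 1) * (k / q)) : Set ℕ) := by
    ext n
    simp only [jumpBlock, Set.mem_image, Set.mem_ofPred_eq, Finset.coe_Ico, Set.mem_Ico]
    exact ⟨fun ⟨x, hx, hxn⟩ => hxn ▸ hx, fun hn => ⟨⟨n, hn.2.trans_le hle⟩, hn, rfl⟩⟩
  rw [← Set.ncard_image_of_injective _ Fin.val_injective, himage, Set.ncard_coe_finset,
    Nat.card_Ico, ← Nat.sub_mul]
  simp

theorem ncard_compl_jumpBlock {k q h : ℕ} (hh : h < q) :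
    (jumpBlock k q h)ᶜ.ncard = k - k / q := by
  rw [Set.ncard_compl, ncard_jumpBlock hh, Nat.card_fin]

theorem hasJumpSub_zero {ℓ k : ℕ} (q : ℕ) (r : Fin ℓ → Fin k) : HasJumpSub q r 0 :=
  ⟨Fin.elim0, fun a => a.elim0, fun a => a.elim0⟩

theorem HasJumpSub.of_succ {ℓ k q j : ℕ} {r : Fin ℓ → Fin k} (h : HasJumpSub q r (j + 1)) :
    HasJumpSub q r j := by
  obtain ⟨i, hi, hb⟩ := h
  exact ⟨i ∘ Fin.castSucc, hi.comp Fin.strictMono_castSucc, fun a => hb a.castSucc⟩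

theorem HasJumpSub.snoc {ℓ k q j : ℕ} {r : Fin ℓ → Fin k} (h : HasJumpSub q r j) (x : Fin k) :
    HasJumpSub q (Fin.snoc r x : Fin (ℓ + 1) → Fin k) j := by
  obtain ⟨i, hi, hb⟩ := h
  refine ⟨Fin.castSucc ∘ i, Fin.strictMono_castSucc.comp hi, fun a => ?_⟩
  simpa using hb a

theorem HasJumpSub.snoc_succ {ℓ k q j : ℕ} {r : Fin ℓ → Fin k} {x : Fin k}
    (h : HasJumpSub q r j) (hx : x ∈ jumpBlock k q j) :
    HasJumpSub q (Fin.snoc r x : Fin (ℓ + 1) → Fin k) (j + 1) := by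
  obtain ⟨i, hi, hb⟩ := h
  refine ⟨Fin.snoc (Fin.castSucc ∘ i) (Fin.last ℓ), ?_, ?_⟩
  · intro a b hab
    induction b using Fin.lastCases with
    | last =>
      induction a using Fin.lastCases with
      | last => exact absurd hab (lt_irrefl _)
      | cast a => simp [Fin.castSucc_lt_last]
    | cast b =>
      induction a using Fin.lastCases with
      | last => exact absurd hab (Fin.castSucc_lt_last b).not_gt
      | cast a => simpa using hi (Fin.castSucc_lt_castSucc_iff.mp hab)
  · intro a
    induction a using Fin.lastCases with
    | last => simpa [jumpBlock] using hx
    | cast a => simpa using hb a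

theorem hasJumpSub_of_snoc_of_ne_last {ℓ k q j : ℕ} {r : Fin ℓ → Fin k} {x : Fin k}
    {i : Fin j → Fin (ℓ + 1)} (hi : StrictMono i) (hne : ∀ a, i a ≠ Fin.last ℓ)
    (hb : ∀ a : Fin j, (Fin.snoc r x : Fin (ℓ + 1) → Fin k) (i a) ∈ jumpBlock k q a) :
    HasJumpSub q r j := by
  refine ⟨fun a => (i a).castPred (hne a), fun a b hab => ?_, fun a => ?_⟩
  · simpa using hi hab
  · have h := hb a
    rw [← Fin.castSucc_castPred (i a) (hne a), Fin.snoc_castSucc] at h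
    exact h

theorem hasJumpSub_snoc_succ_iff {ℓ k q j : ℕ} {r : Fin ℓ → Fin k} {x : Fin k} :
    HasJumpSub q (Fin.snoc r x : Fin (ℓ + 1) → Fin k) (j + 1) ↔
      HasJumpSub q r (j + 1) ∨ (HasJumpSub q r j ∧ x ∈ jumpBlock k q j) := by
  refine ⟨?_, fun h => h.elim (fun h => h.snoc x) fun h => h.1.snoc_succ h.2⟩
  rintro ⟨i, hi, hb⟩
  by_cases hlast : i (Fin.last j) = Fin.last ℓ
  · refine Or.inr ⟨hasJumpSub_of_snoc_of_ne_last (hi.comp Fin.strictMono_castSucc)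
      (fun a => ?_) fun a => hb a.castSucc, ?_⟩
    · exact ((hi (Fin.castSucc_lt_last a)).trans_le (Fin.le_last _)).ne
    · have h := hb (Fin.last j)
      rw [hlast, Fin.snoc_last] at h
      exact h
  · refine Or.inl (hasJumpSub_of_snoc_of_ne_last hi (fun a => ?_) hb)
    exact ((hi.monotone (Fin.le_last a)).trans_lt (Fin.lt_last_iff_ne_last.mpr hlast)).ne

theorem ncard_eq_of_snoc_mem_iff {ℓ k : ℕ} {S : Set (Fin (ℓ + 1) → Fin k)}
    {T : Set (Fin k × (Fin ℓ → Fin k))}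
    (h : ∀ x r, (Fin.snoc r x : Fin (ℓ + 1) → Fin k) ∈ S ↔ (x, r) ∈ T) :
    S.ncard = T.ncard := by
  have hST : T = Fin.snocEquiv (fun _ => Fin k) ⁻¹' S := by
    ext ⟨x, r⟩
    exact (h x r).symm
  rw [hST, ← Equiv.image_symm_eq_preimage,
    Set.ncard_image_of_injective _ (Equiv.injective _)]

theorem ncard_exactJumpSet_succ_zero {k q ℓ : ℕ} (hq : 0 < q) :
    (exactJumpSet k q (ℓ + 1) 0).ncard = (k - k / q) * (exactJumpSet k q ℓ 0).ncard := by
  rw [← ncard_compl_jumpBlock hq, ← Set.ncard_prod]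
  refine ncard_eq_of_snoc_mem_iff fun x r => ?_
  simp only [exactJumpSet, Set.mem_ofPred_eq, hasJumpSub_snoc_succ_iff, hasJumpSub_zero,
    Set.mem_prod, Set.mem_compl_iff]
  tauto

theorem ncard_exactJumpSet_succ_succ {k q ℓ j : ℕ} (hj : j + 1 < q) :
    (exactJumpSet k q (ℓ + 1) (j + 1)).ncard =
      (k - k / q) * (exactJumpSet k q ℓ (j + 1)).ncard +
        k / q * (exactJumpSet k q ℓ j).ncard := by
  rw [← ncard_compl_jumpBlock hj, ← Set.ncard_prod]
  rw [← ncard_jumpBlock (k := k) (Nat.lt_of_succ_lt hj)]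
  rw [← Set.ncard_prod, ← Set.ncard_union_eq]
  · refine ncard_eq_of_snoc_mem_iff fun x r => ?_
    have h₁ : HasJumpSub q r (j + 1) → HasJumpSub q r j := HasJumpSub.of_succ
    have h₂ : HasJumpSub q r (j + 1 + 1) → HasJumpSub q r (j + 1) := HasJumpSub.of_succ
    simp only [exactJumpSet, Set.mem_ofPred_eq, hasJumpSub_snoc_succ_iff, Set.mem_union,
      Set.mem_prod, Set.mem_compl_iff]
    tauto
  · rw [Set.disjoint_left]
    rintro ⟨x, r⟩ h h'
    exact h'.2.2 h.2.1

theorem ncard_exactJumpSet {k q : ℕ} (ℓ : ℕ) {j : ℕ} (hj : j < q) :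
    (exactJumpSet k q ℓ j).ncard =
      ℓ.choose j * (k / q) ^ j * (k - k / q) ^ (ℓ - j) := by
  induction ℓ generalizing j with
  | zero =>
    have hnone (m : ℕ) (r : Fin 0 → Fin k) : ¬ HasJumpSub q r (m + 1) :=
      fun ⟨i, _⟩ => (i 0).elim0
    cases j with
    | zero =>
      have huniv : exactJumpSet k q 0 0 = Set.univ :=
        Set.eq_univ_of_forall fun r => ⟨hasJumpSub_zero q r, hnone 0 r⟩
      simp [huniv, Set.ncard_univ]
    | succ j =>
      have hempty : exactJumpSet k q 0 (j + 1) = ∅ :=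
        Set.eq_empty_of_forall_notMem fun r hr => hnone j r hr.1
      simp [hempty]
  | succ ℓ ih =>
    cases j with
    | zero =>
      rw [ncard_exactJumpSet_succ_zero hj, ih hj]
      simp [pow_succ']
    | succ j =>
      rw [ncard_exactJumpSet_succ_succ hj, ih hj, ih (Nat.lt_of_succ_lt hj),
        Nat.choose_succ_succ, Nat.add_sub_add_right]
      rcases Nat.lt_or_ge j ℓ with hlt | hge
      · obtain ⟨d, rfl⟩ := Nat.exists_eq_add_of_lt hlt
        rw [show j + d + 1 - (j + 1) = d by omega, show j + d + 1 - j = d + 1 by omega]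
        ring
      · rw [Nat.choose_eq_zero_of_lt (Nat.lt_succ_of_le hge)]
        ring

theorem count_jump_j_not_j_succ (k q ℓ j : ℕ) (hk : 2 ≤ k) (hq : 2 ≤ q)
    (hdvd : q ∣ k) (hℓ : 1 ≤ ℓ) (hj : j < q) :
    Nat.card {r : Fin ℓ → Fin k // HasJumpSub q r j ∧ ¬ HasJumpSub q r (j + 1)} =
      ℓ.choose j * (k / q) ^ j * (k - k / q) ^ (ℓ - j) :=
  ncard_exactJumpSet ℓ hj
end

section
/- Let k ≥ 2 and q ≥ 2 be integers with q dividing k, let ℓ ≥ 1 be an integer, and partition {0,1,...,k-1} into the q blocks B_h = {h·(k/q), ..., (h+1)·(k/q)-1} for h = 0,...,q-1. The number of sequences r = r_0, r_1, ..., r_{ℓ-1} with entries in {0,1,...,k-1} that contain no jump subsequence of length q equals Σ_{j=0}^{q-1} C(ℓ,j)·(k/q)^j·(k - k/q)^{ℓ-j}. Equivalently, for a uniformly random such sequence, the probability p''_{ℓ,k,q} of containing no jump subsequence of length q equals (1/k^ℓ)·Σ_{j=0}^{q-1} C(ℓ,j)·(k/q)^j·(k - k/q)^{ℓ-j}. 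-/
theorem not_hasJumpSub_of_lt {ℓ k q j : ℕ} (hj : ℓ < j) (r : Fin ℓ → Fin k) :
    ¬ HasJumpSub q r j := by
  rintro ⟨i, hi, -⟩
  have := Fintype.card_le_of_injective i hi.injective
  simp only [Fintype.card_fin] at this
  omega

theorem hasJumpSub_snoc_of_hasJumpSub {ℓ k q j : ℕ} {r : Fin ℓ → Fin k} (a : Fin k)
    (h : HasJumpSub q r j) : HasJumpSub q (Fin.snoc r a : Fin (ℓ + 1) → Fin k) j := by
  obtain ⟨i, hi, hB⟩ := h
  exact ⟨fun x => (i x).castSucc, fun x y hxy => hi hxy, fun x => by simpa using hB x⟩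

/-- A jump subsequence of a one-term extension that avoids the last index. -/
theorem hasJumpSub_of_snoc {ℓ k q j : ℕ} {r : Fin ℓ → Fin k} {a : Fin k}
    (i : Fin j → Fin (ℓ + 1)) (hi : StrictMono i) (hlast : ∀ x, i x ≠ Fin.last ℓ)
    (hB : ∀ h : Fin j,
      (h : ℕ) * (k / q) ≤ ((Fin.snoc r a : Fin (ℓ + 1) → Fin k) (i h) : ℕ) ∧
      ((Fin.snoc r a : Fin (ℓ + 1) → Fin k) (i h) : ℕ) < ((h : ℕ) + 1) * (k / q)) :
    HasJumpSub q r j := by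
  refine ⟨fun x => (i x).castPred (hlast x), fun x y hxy => ?_, fun x => ?_⟩
  · simpa using hi hxy
  · have h := hB x
    rw [← Fin.castSucc_castPred (i x) (hlast x)] at h
    simpa only [Fin.snoc_castSucc] using h

theorem hasJumpSub_snoc_of_mem {ℓ k q j : ℕ} (r : Fin ℓ → Fin k) {a : Fin k}
    (ha : j * (k / q) ≤ (a : ℕ) ∧ (a : ℕ) < (j + 1) * (k / q)) :
    HasJumpSub q (Fin.snoc r a : Fin (ℓ + 1) → Fin k) (j + 1) ↔ HasJumpSub q r j := by
  constructor
  · rintro ⟨i, hi, hB⟩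
    refine hasJumpSub_of_snoc (a := a) (fun x => i x.castSucc)
      (hi.comp Fin.strictMono_castSucc) (fun x => ?_) (fun x => hB x.castSucc)
    exact ((hi (Fin.castSucc_lt_last x)).trans_le (Fin.le_last _)).ne
  · rintro ⟨i, hi, hB⟩
    refine ⟨Fin.snoc (fun x => (i x).castSucc) (Fin.last ℓ), fun x y hxy => ?_, fun x => ?_⟩
    · induction x using Fin.lastCases with
      | last => exact absurd hxy (Fin.le_last y).not_gt
      | cast x =>
        induction y using Fin.lastCases with
        | last => simp
        | cast y => simpa using hi (Fin.castSucc_lt_castSucc_iff.mp hxy)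
    · induction x using Fin.lastCases with
      | last => simpa using ha
      | cast x => simpa using hB x

theorem hasJumpSub_snoc_of_not_mem {ℓ k q j : ℕ} (r : Fin ℓ → Fin k) {a : Fin k}
    (ha : ¬ (j * (k / q) ≤ (a : ℕ) ∧ (a : ℕ) < (j + 1) * (k / q))) :
    HasJumpSub q (Fin.snoc r a : Fin (ℓ + 1) → Fin k) (j + 1) ↔ HasJumpSub q r (j + 1) := by
  refine ⟨?_, hasJumpSub_snoc_of_hasJumpSub a⟩
  rintro ⟨i, hi, hB⟩
  have hne : i (Fin.last j) ≠ Fin.last ℓ := fun h => ha (by simpa [h] using hB (Fin.last j))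
  refine hasJumpSub_of_snoc i hi (fun x => ?_) hB
  exact ((hi.monotone (Fin.le_last x)).trans_lt (Fin.lt_last_iff_ne_last.mpr hne)).ne

theorem card_filter_block {k q j : ℕ} (hdvd : q ∣ k) (hj : j < q) :
    (Finset.univ.filter fun a : Fin k =>
      j * (k / q) ≤ (a : ℕ) ∧ (a : ℕ) < (j + 1) * (k / q)).card = k / q := by
  have hk : (j + 1) * (k / q) ≤ k :=
    (Nat.mul_le_mul_right _ hj).trans (Nat.mul_div_cancel' hdvd).le
  rw [← Finset.card_map Fin.valEmbedding]
  have : (Finset.univ.filter fun a : Fin k =>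
      j * (k / q) ≤ (a : ℕ) ∧ (a : ℕ) < (j + 1) * (k / q)).map Fin.valEmbedding =
      Finset.Ico (j * (k / q)) ((j + 1) * (k / q)) := by
    ext x
    simp only [Finset.mem_map, Finset.mem_filter, Finset.mem_univ, true_and,
      Fin.valEmbedding_apply, Finset.mem_Ico]
    exact ⟨by rintro ⟨a, ha, rfl⟩; exact ha, fun hx => ⟨⟨x, hx.2.trans_le hk⟩, hx, rfl⟩⟩
  rw [this, Nat.card_Ico, add_one_mul, Nat.add_sub_cancel_left]

open Classical in
theorem card_not_hasJumpSub_succ {ℓ k q j : ℕ} (hdvd : q ∣ k) (hj : j < q) :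
    Nat.card {r : Fin (ℓ + 1) → Fin k // ¬ HasJumpSub q r (j + 1)} =
      k / q * Nat.card {r : Fin ℓ → Fin k // ¬ HasJumpSub q r j} +
      (k - k / q) * Nat.card {r : Fin ℓ → Fin k // ¬ HasJumpSub q r (j + 1)} := by
  have hcompl : (Finset.univ.filter fun a : Fin k =>
      ¬ (j * (k / q) ≤ (a : ℕ) ∧ (a : ℕ) < (j + 1) * (k / q))).card = k - k / q := by
    have := Finset.card_filter_add_card_filter_not (s := (Finset.univ : Finset (Fin k)))
      (fun a : Fin k => j * (k / q) ≤ (a : ℕ) ∧ (a : ℕ) < (j + 1) * (k / q))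
    rw [card_filter_block hdvd hj, Finset.card_univ, Fintype.card_fin] at this
    omega
  simp only [Nat.card_eq_fintype_card, Fintype.card_subtype, Finset.card_filter _ Finset.univ]
  rw [← (Fin.snocEquiv fun _ : Fin (ℓ + 1) => Fin k).sum_comp, Fintype.sum_prod_type,
    ← Finset.sum_filter_add_sum_filter_not Finset.univ
      (fun a : Fin k => j * (k / q) ≤ (a : ℕ) ∧ (a : ℕ) < (j + 1) * (k / q))]
  congr 1
  · rw [Finset.sum_congr rfl (g := fun _ => ∑ r : Fin ℓ → Fin k,
      if ¬ HasJumpSub q r j then 1 else 0), Finset.sum_const, card_filter_block hdvd hj,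
      smul_eq_mul]
    intro a ha
    refine Finset.sum_congr rfl fun r _ => ?_
    exact if_congr (not_congr (hasJumpSub_snoc_of_mem r (Finset.mem_filter.mp ha).2)) rfl rfl
  · rw [Finset.sum_congr rfl (g := fun _ => ∑ r : Fin ℓ → Fin k,
      if ¬ HasJumpSub q r (j + 1) then 1 else 0), Finset.sum_const, hcompl, smul_eq_mul]
    intro a ha
    refine Finset.sum_congr rfl fun r _ => ?_
    exact if_congr (not_congr (hasJumpSub_snoc_of_not_mem r (Finset.mem_filter.mp ha).2)) rfl rfl

/-- Partial sums of the binomial expansion satisfy Pascal's recursion. -/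
theorem sum_range_choose_mul_pow_succ (s t ℓ j : ℕ) :
    ∑ i ∈ Finset.range (j + 1), (ℓ + 1).choose i * s ^ i * t ^ (ℓ + 1 - i) =
      s * ∑ i ∈ Finset.range j, ℓ.choose i * s ^ i * t ^ (ℓ - i) +
      t * ∑ i ∈ Finset.range (j + 1), ℓ.choose i * s ^ i * t ^ (ℓ - i) := by
  induction j with
  | zero => simp [pow_succ, mul_comm]
  | succ j ih =>
    have hterm : (ℓ + 1).choose (j + 1) * s ^ (j + 1) * t ^ (ℓ + 1 - (j + 1)) =
        s * (ℓ.choose j * s ^ j * t ^ (ℓ - j)) +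
        t * (ℓ.choose (j + 1) * s ^ (j + 1) * t ^ (ℓ - (j + 1))) := by
      rw [Nat.choose_succ_succ', Nat.add_sub_add_right]
      rcases lt_or_ge j ℓ with h | h
      · obtain ⟨d, rfl⟩ := Nat.exists_eq_add_of_lt h
        rw [show j + d + 1 - j = d + 1 by omega, show j + d + 1 - (j + 1) = d by omega]
        ring
      · rw [Nat.choose_eq_zero_of_lt (Nat.lt_succ_of_le h)]
        ring
    rw [Finset.sum_range_succ, ih, hterm, Finset.sum_range_succ _ j,
      Finset.sum_range_succ _ (j + 1), Finset.sum_range_succ _ j]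
    ring

theorem card_not_hasJumpSub {k q : ℕ} (hdvd : q ∣ k) (ℓ j : ℕ) (hj : j ≤ q) :
    Nat.card {r : Fin ℓ → Fin k // ¬ HasJumpSub q r j} =
      ∑ i ∈ Finset.range j, ℓ.choose i * (k / q) ^ i * (k - k / q) ^ (ℓ - i) := by
  induction ℓ generalizing j with
  | zero =>
    cases j with
    | zero => simp [hasJumpSub_zero]
    | succ j =>
      simp [not_hasJumpSub_of_lt (Nat.succ_pos j), Finset.sum_range_succ']
  | succ ℓ ih =>
    cases j with
    | zero => simp [hasJumpSub_zero]
    | succ j =>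
      rw [card_not_hasJumpSub_succ hdvd hj, ih j (by omega), ih (j + 1) hj,
        sum_range_choose_mul_pow_succ]

theorem count_no_jump_subsequence (k q ℓ : ℕ) (hk : 2 ≤ k) (hq : 2 ≤ q)
    (hdvd : q ∣ k) (hℓ : 1 ≤ ℓ) :
    Nat.card {r : Fin ℓ → Fin k // ¬ HasJumpSub q r q} =
      ∑ j ∈ Finset.range q, ℓ.choose j * (k / q) ^ j * (k - k / q) ^ (ℓ - j) ∧
    (Nat.card {r : Fin ℓ → Fin k // ¬ HasJumpSub q r q} : ℝ) / (k : ℝ) ^ ℓ =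
      (1 / (k : ℝ) ^ ℓ) *
        ∑ j ∈ Finset.range q,
          (ℓ.choose j : ℝ) * ((k / q : ℕ) : ℝ) ^ j * ((k - k / q : ℕ) : ℝ) ^ (ℓ - j) := by
  have h := card_not_hasJumpSub hdvd ℓ q le_rfl
  refine ⟨h, ?_⟩
  rw [h]
  push_cast
  ring
end

section
/- Let k ≥ 2 and q ≥ 2 be integers with q dividing k, and let ℓ ≥ k be an integer. Then the probability p'_{ℓ,k,q} that a uniformly random sequence r = r_0, ..., r_{ℓ-1} with entries in {0,1,...,k-1} contains no strictly increasing subsequence of length q satisfies p'_{ℓ,k,q} ≤ e^{-ℓ/q}·(2ℓ/q)^q. Equivalently, the number of sequences of length ℓ over {0,1,...,k-1} with no strictly increasing subsequence of length q is at most k^ℓ·e^{-ℓ/q}·(2ℓ/q)^q. -/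
/-- The sequence `r : Fin ℓ → Fin k` contains a strictly increasing subsequence
of length `q`. -/
def HasIncrSub {ℓ k : ℕ} (r : Fin ℓ → Fin k) (q : ℕ) : Prop :=
  ∃ i : Fin q → Fin ℓ, StrictMono i ∧ StrictMono fun h => r (i h)

/-- The sequence `r` meets the sets `B 0, …, B (m - 1)` in this order. -/
def MeetsInOrder {α : Type*} {n : ℕ} (B : ℕ → Finset α) (m : ℕ) (r : Fin n → α) : Prop :=
  ∃ i : Fin m → Fin n, StrictMono i ∧ ∀ h : Fin m, r (i h) ∈ B h

theorem meetsInOrder_zero {α : Type*} {n : ℕ} (B : ℕ → Finset α) (r : Fin n → α) :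
    MeetsInOrder B 0 r :=
  ⟨Fin.elim0, fun a => a.elim0, fun a => a.elim0⟩

theorem MeetsInOrder.cons {α : Type*} {n m : ℕ} {B : ℕ → Finset α} {r : Fin n → α}
    (hr : MeetsInOrder B m r) (a : α) : MeetsInOrder B m (Fin.cons a r : Fin (n + 1) → α) := by
  obtain ⟨i, hi, hB⟩ := hr
  exact ⟨fun h => (i h).succ, fun x y hxy => Fin.succ_lt_succ_iff.2 (hi hxy),
    fun h => by simpa using hB h⟩

theorem MeetsInOrder.cons_of_mem {α : Type*} {n m : ℕ} {B : ℕ → Finset α} {r : Fin n → α}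
    (hr : MeetsInOrder (fun h => B (h + 1)) m r) {a : α} (ha : a ∈ B 0) :
    MeetsInOrder B (m + 1) (Fin.cons a r : Fin (n + 1) → α) := by
  obtain ⟨i, hi, hB⟩ := hr
  refine ⟨Fin.cons 0 fun h => (i h).succ, ?_, ?_⟩
  · intro x y hxy
    cases y using Fin.cases with
    | zero => exact absurd hxy (Fin.not_lt_zero x)
    | succ y =>
      cases x using Fin.cases with
      | zero => simp
      | succ x => simpa using hi (Fin.succ_lt_succ_iff.1 hxy)
  · intro h
    cases h using Fin.cases with
    | zero => simpa using ha
    | succ h => simpa using hB h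

open Classical in
/-- Exponential-moment bound for the number of sequences which fail to meet `m` sets of equal
cardinality `b` in a prescribed order. -/
theorem card_not_meetsInOrder_mul_pow_le {α : Type*} [Fintype α] {b : ℕ} {t : ℝ}
    (hbα : b ≤ Fintype.card α) (ht : 0 ≤ t) (ht1 : t ≤ 1) (n : ℕ) : ∀ (m : ℕ) (B : ℕ → Finset α), (∀ h < m, (B h).card = b) →
      (Fintype.card {r : Fin n → α // ¬ MeetsInOrder B m r} : ℝ) * t ^ m ≤
        t * (Fintype.card α - b + b * t) ^ n := by
  have card_zero (n : ℕ) (B : ℕ → Finset α) :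
      Fintype.card {r : Fin n → α // ¬ MeetsInOrder B 0 r} = 0 :=
    Fintype.card_eq_zero_iff.2 ⟨fun r => r.2 (meetsInOrder_zero B r.1)⟩
  have hc : (0 : ℝ) ≤ Fintype.card α - b := sub_nonneg.2 (by exact_mod_cast hbα)
  induction n with
  | zero =>
    intro m B hB
    cases m with
    | zero => simpa [card_zero] using ht
    | succ m =>
      have h1 : (Fintype.card {r : Fin 0 → α // ¬ MeetsInOrder B (m + 1) r} : ℝ) ≤ 1 := by
        exact_mod_cast (Fintype.card_subtype_le _).trans (by simp)
      calc _ ≤ 1 * t ^ (m + 1) := by gcongr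
        _ ≤ t * 1 := by
          rw [pow_succ', one_mul]
          exact mul_le_mul_of_nonneg_left (pow_le_one₀ ht ht1) ht
        _ = _ := by simp
  | succ n ih =>
    intro m B hB
    cases m with
    | zero =>
      rw [card_zero, Nat.cast_zero, zero_mul]
      positivity
    | succ m =>
      have hb : ((B 0).card : ℝ) = b := by rw [hB 0 (by omega)]
      have hbc : ((B 0)ᶜ.card : ℝ) = Fintype.card α - b := by
        rw [Finset.card_compl, Nat.cast_sub (Finset.card_le_univ _), hb]
      set N := Fintype.card {r : Fin n → α // ¬ MeetsInOrder (fun h => B (h + 1)) m r}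
      set M := Fintype.card {r : Fin n → α // ¬ MeetsInOrder B (m + 1) r}
      have hN : (N : ℝ) * t ^ m ≤ t * (Fintype.card α - b + b * t) ^ n :=
        ih m _ fun h hh => hB (h + 1) (by omega)
      have hM : (M : ℝ) * t ^ (m + 1) ≤ t * (Fintype.card α - b + b * t) ^ n := ih (m + 1) B hB
      have key : Fintype.card {r : Fin (n + 1) → α // ¬ MeetsInOrder B (m + 1) r} ≤
          (B 0).card * N + (B 0)ᶜ.card * M := by
        have h1 : Fintype.card {r : Fin (n + 1) → α // ¬ MeetsInOrder B (m + 1) r} =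
            ∑ a : α, Fintype.card
              {r : Fin n → α // ¬ MeetsInOrder B (m + 1) (Fin.cons a r : Fin (n + 1) → α)} := by
          simp only [Fintype.card_subtype, Finset.card_filter]
          rw [← Fintype.sum_prod_type']
          exact (Fintype.sum_equiv (Fin.consEquiv fun _ => α) _ _ fun x => rfl).symm
        rw [h1, ← Finset.sum_add_sum_compl (B 0)]
        refine add_le_add ?_ ?_
        · refine Finset.sum_le_card_nsmul _ _ _ fun a ha => ?_
          exact Fintype.card_subtype_mono _ _ fun r hr hr' => hr (hr'.cons_of_mem ha)
        · refine Finset.sum_le_card_nsmul _ _ _ fun a _ => ?_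
          exact Fintype.card_subtype_mono _ _ fun r hr hr' => hr (hr'.cons a)
      have key' : (Fintype.card {r : Fin (n + 1) → α // ¬ MeetsInOrder B (m + 1) r} : ℝ) ≤
          b * N + (Fintype.card α - b) * M := by
        rw [← hbc, ← hb]
        exact_mod_cast key
      calc _ ≤ (b * N + (Fintype.card α - b) * M) * t ^ (m + 1) := by gcongr
        _ = b * t * (N * t ^ m) + (Fintype.card α - b) * (M * t ^ (m + 1)) := by ring
        _ ≤ b * t * (t * (Fintype.card α - b + b * t) ^ n) +
            (Fintype.card α - b) * (t * (Fintype.card α - b + b * t) ^ n) := by gcongr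
        _ = _ := by ring

/-- The `h`-th block of `b` consecutive letters. -/
def letterBlock (k b h : ℕ) : Finset (Fin k) :=
  Finset.univ.filter fun a => (a : ℕ) / b = h

theorem card_letterBlock {q b h : ℕ} (hb : 0 < b) (hh : h < q) :
    (letterBlock (q * b) b h).card = b := by
  have hle : (h + 1) * b ≤ q * b := Nat.mul_le_mul_right b hh
  have : (letterBlock (q * b) b h).map Fin.valEmbedding = Finset.Ico (h * b) ((h + 1) * b) := by
    ext x
    simp only [letterBlock, Finset.mem_map, Finset.mem_filter, Finset.mem_univ, true_and,
      Fin.valEmbedding_apply, Finset.mem_Ico]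
    constructor
    · rintro ⟨a, ha, rfl⟩
      exact ⟨(Nat.le_div_iff_mul_le hb).1 ha.ge, (Nat.div_lt_iff_lt_mul hb).1 (by omega)⟩
    · intro hx
      have h1 := (Nat.le_div_iff_mul_le hb).2 hx.1
      have h2 := (Nat.div_lt_iff_lt_mul hb).2 hx.2
      exact ⟨⟨x, hx.2.trans_le hle⟩, by dsimp only; omega, rfl⟩
  rw [← Finset.card_map Fin.valEmbedding, this, Nat.card_Ico, add_mul, one_mul,
    Nat.add_sub_cancel_left]

theorem MeetsInOrder.hasIncrSub {ℓ k b q : ℕ} {r : Fin ℓ → Fin k}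
    (hr : MeetsInOrder (letterBlock k b) q r) : HasIncrSub r q := by
  obtain ⟨i, hi, hB⟩ := hr
  refine ⟨i, hi, fun x y hxy => ?_⟩
  have hx := hB x
  have hy := hB y
  simp only [letterBlock, Finset.mem_filter, Finset.mem_univ, true_and] at hx hy
  by_contra! hle
  have := Nat.div_le_div_right (c := b) (Fin.le_def.1 hle)
  rw [hx, hy] at this
  exact absurd hxy (not_lt.2 this)

/-- Bound on the number of sequences without increasing subsequence of length `q`, with the
constant `e * (q / ℓ)`. -/
theorem card_not_hasIncrSub_le {q b ℓ : ℕ} (hq : 0 < q) (hb : 0 < b) (hℓ : q ≤ ℓ) :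
    (Nat.card {r : Fin ℓ → Fin (q * b) // ¬ HasIncrSub r q} : ℝ) ≤
      ((q * b : ℕ) : ℝ) ^ ℓ * Real.exp (-(ℓ : ℝ) / q) *
        (Real.exp 1 * ((q : ℝ) / ℓ) * ((ℓ : ℝ) / q) ^ q) := by
  classical
  have hq' : (0 : ℝ) < q := by exact_mod_cast hq
  have hb' : (0 : ℝ) < b := by exact_mod_cast hb
  have hℓ' : (0 : ℝ) < ℓ := by exact_mod_cast hq.trans_le hℓ
  set t : ℝ := (q : ℝ) / ℓ with ht
  have ht0 : 0 < t := by positivity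
  have ht1 : t ≤ 1 := (div_le_one hℓ').2 (by exact_mod_cast hℓ)
  have hcard := card_not_meetsInOrder_mul_pow_le
    (by simpa using Nat.le_mul_of_pos_left b hq) ht0.le ht1 ℓ q (letterBlock (q * b) b)
    fun h hh => card_letterBlock hb hh
  have hmono : Nat.card {r : Fin ℓ → Fin (q * b) // ¬ HasIncrSub r q} ≤
      Fintype.card {r : Fin ℓ → Fin (q * b) // ¬ MeetsInOrder (letterBlock (q * b) b) q r} := by
    rw [Nat.card_eq_fintype_card]
    exact Fintype.card_subtype_mono _ _ fun r hr hr' => hr hr'.hasIncrSub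
  have hbase : ((q * b : ℕ) : ℝ) - b + b * t ≤ (q * b : ℕ) * Real.exp ((t - 1) / q) := by
    have h := Real.add_one_le_exp ((t - 1) / q)
    calc ((q * b : ℕ) : ℝ) - b + b * t = (q * b : ℕ) * ((t - 1) / q + 1) := by
          push_cast; field_simp; ring
      _ ≤ _ := by gcongr
  have hbase0 : 0 ≤ ((q * b : ℕ) : ℝ) - b + b * t := by
    have : (b : ℝ) ≤ (q * b : ℕ) := by exact_mod_cast Nat.le_mul_of_pos_left b hq
    have : 0 ≤ b * t := by positivity
    linarith
  have hexp : Real.exp ((t - 1) / q) ^ ℓ = Real.exp (-(ℓ : ℝ) / q) * Real.exp 1 := by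
    rw [← Real.exp_nat_mul, ← Real.exp_add]
    congr 1
    rw [ht]; field_simp; ring
  have hinv : ((ℓ : ℝ) / q) = t⁻¹ := by rw [ht, inv_div]
  rw [Fintype.card_fin] at hcard
  rw [hinv, inv_pow]
  calc (Nat.card {r : Fin ℓ → Fin (q * b) // ¬ HasIncrSub r q} : ℝ)
      ≤ t * (((q * b : ℕ) : ℝ) - b + b * t) ^ ℓ / t ^ q := by
        rw [le_div_iff₀ (by positivity)]
        refine le_trans ?_ hcard
        gcongr
    _ ≤ t * ((q * b : ℕ) * Real.exp ((t - 1) / q)) ^ ℓ / t ^ q := by gcongr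
    _ = _ := by rw [mul_pow, hexp]; ring

theorem prob_no_increasing_subsequence_le (k q ℓ : ℕ) (hk : 2 ≤ k) (hq : 2 ≤ q)
    (hdvd : q ∣ k) (hℓ : k ≤ ℓ) :
    (Nat.card {r : Fin ℓ → Fin k // ¬ HasIncrSub r q} : ℝ) / (k : ℝ) ^ ℓ ≤
      Real.exp (-(ℓ : ℝ) / (q : ℝ)) * (2 * (ℓ : ℝ) / (q : ℝ)) ^ q ∧
    (Nat.card {r : Fin ℓ → Fin k // ¬ HasIncrSub r q} : ℝ) ≤
      (k : ℝ) ^ ℓ * Real.exp (-(ℓ : ℝ) / (q : ℝ)) * (2 * (ℓ : ℝ) / (q : ℝ)) ^ q := by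
  have hmain : (Nat.card {r : Fin ℓ → Fin k // ¬ HasIncrSub r q} : ℝ) ≤
      (k : ℝ) ^ ℓ * Real.exp (-(ℓ : ℝ) / (q : ℝ)) * (2 * (ℓ : ℝ) / (q : ℝ)) ^ q := by
    have hqℓ : q ≤ ℓ := (Nat.le_of_dvd (by omega) hdvd).trans hℓ
    obtain ⟨b, rfl⟩ := hdvd
    have hb : 0 < b := Nat.pos_of_ne_zero (by rintro rfl; omega)
    refine (card_not_hasIncrSub_le (by omega) hb hqℓ).trans ?_
    rw [mul_div_assoc, mul_pow]
    have hratio : (q : ℝ) / ℓ ≤ 1 :=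
      div_le_one_of_le₀ (by exact_mod_cast hqℓ) (by positivity)
    have hconst : Real.exp 1 * ((q : ℝ) / ℓ) ≤ 2 ^ q :=
      calc Real.exp 1 * ((q : ℝ) / ℓ) ≤ Real.exp 1 * 1 := by gcongr
        _ ≤ 2 ^ 2 := by linarith [Real.exp_one_lt_d9]
        _ ≤ 2 ^ q := pow_le_pow_right₀ (by norm_num) hq
    gcongr
  refine ⟨?_, hmain⟩
  have hk' : (0 : ℝ) < k := by exact_mod_cast (by omega : 0 < k)
  rw [div_le_iff₀ (by positivity)]
  exact hmain.trans_eq (by ring)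
end
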